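/- Let Ω = {(y₁,y₂) : 0 < y₁ < L, 0 < y₂ < 1/2} and Σ = {y₂ = 1/2}. Given Ŵ = (Ŵ₁,Ŵ₂,Ŵ₃) in the set J(δ₁) = {W : Σ_{j=1}^3 ‖W_j‖_{1,α;Ω}^{(−α,Σ)} ≤ δ₁, W₂(y₁,0)=W₂(L,y₂)=W₃(y₁,0)=0}, the angular momentum conservation ∂_{y₁}(ru_θ) = 0 determines the swirl velocity as W₃(y₁,y₂) = Λ̂(y₂)/r̂(y₁,y₂), where Λ̂(y₂) = (2∫₀^{y₂} 2s/J̃₀(s) ds)^{1/2} ν̃₀(y₂) and r̂(y₁,y₂) = (2∫₀^{y₂} 2s/(ρ̂(Ŵ₁+u_b⁻, Ŵ₂, Ŵ₃, Ã₀, B̃₀)(Ŵ₁+u_b⁻))(y₁,s) ds)^{1/2}; moreover W₃ obeys the estimate ‖W₃‖_{1,α;Ω}^{(−α,Σ)} ≤ Cσ_cd with C > 0 depending only on the background state (U_b⁻, L, α), where σ_cd = ‖(J₀,ν₀,A₀,B₀) − (J_b⁻, 0, A_b⁻, B_b⁻)‖_{1,α;[0,1/2]}. -/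

import Mathlib

noncomputable section
open Real Set MeasureTheory

namespace ContactDisc

variable {E F : Type*} [NormedAddCommGroup E] [NormedSpace ℝ E]
  [NormedAddCommGroup F] [NormedSpace ℝ F]

/-- The set of weighted sup values `δ_x^{max(i+k,0)} |D^i u(x)|`, `x ∈ D`,
where `δ_x` is the distance from `x` to the boundary portion `P`. -/
def wSupSet (i : ℕ) (k : ℝ) (D P : Set E) (u : E → F) : Set ℝ :=
  {t | ∃ x ∈ D, t = Metric.infDist x P ^ max ((i : ℝ) + k) 0 * ‖iteratedFDeriv ℝ i u x‖}

/-- The set of weighted Hölder quotients of the `m`-th derivative. -/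
def wSemiSet (m : ℕ) (α k : ℝ) (D P : Set E) (u : E → F) : Set ℝ :=
  {t | ∃ x ∈ D, ∃ y ∈ D, x ≠ y ∧
    t = min (Metric.infDist x P) (Metric.infDist y P) ^ max ((m : ℝ) + α + k) 0 *
        (‖iteratedFDeriv ℝ m u x - iteratedFDeriv ℝ m u y‖ / ‖x - y‖ ^ α)}

/-- The weighted Hölder norm `‖u‖_{m,α;D}^{(k,P)}`. -/
def wNorm (m : ℕ) (α k : ℝ) (D P : Set E) (u : E → F) : ℝ :=
  (∑ i ∈ Finset.range (m + 1), sSup (wSupSet i k D P u)) + sSup (wSemiSet m α k D P u)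

/-- Membership in the weighted Hölder space `C_{m,α}^{(k,P)}(D)`. -/
def MemW (m : ℕ) (α k : ℝ) (D P : Set E) (u : E → F) : Prop :=
  ContDiffOn ℝ m u D ∧ (∀ i ≤ m, BddAbove (wSupSet i k D P u)) ∧
    BddAbove (wSemiSet m α k D P u)

def hSupSet (i : ℕ) (D : Set E) (u : E → F) : Set ℝ :=
  {t | ∃ x ∈ D, t = ‖iteratedFDeriv ℝ i u x‖}

def hSemiSet (m : ℕ) (α : ℝ) (D : Set E) (u : E → F) : Set ℝ :=
  {t | ∃ x ∈ D, ∃ y ∈ D, x ≠ y ∧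
    t = ‖iteratedFDeriv ℝ m u x - iteratedFDeriv ℝ m u y‖ / ‖x - y‖ ^ α}

/-- The Hölder norm `‖u‖_{m,α;D}`. -/
def hNorm (m : ℕ) (α : ℝ) (D : Set E) (u : E → F) : ℝ :=
  (∑ i ∈ Finset.range (m + 1), sSup (hSupSet i D u)) + sSup (hSemiSet m α D u)

/-- Membership in the Hölder space `C^{m,α}(D)`. -/
def MemH (m : ℕ) (α : ℝ) (D : Set E) (u : E → F) : Prop :=
  ContDiffOn ℝ m u D ∧ (∀ i ≤ m, BddAbove (hSupSet i D u)) ∧ BddAbove (hSemiSet m α D u)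

/-- Partial derivative in the first (axial) variable. -/
def dx (u : ℝ × ℝ → ℝ) (p : ℝ × ℝ) : ℝ := fderiv ℝ u p (1, 0)

/-- Partial derivative in the second (radial/Lagrangian) variable. -/
def dr (u : ℝ × ℝ → ℝ) (p : ℝ × ℝ) : ℝ := fderiv ℝ u p (0, 1)

/-- The Lagrangian domain `Ω = (0,L) × (0, 1/2)`. -/
def Om (L : ℝ) : Set (ℝ × ℝ) := Ioo 0 L ×ˢ Ioo 0 (1 / 2)

/-- The (straightened) contact discontinuity `Σ = (0,L) × {1/2}`. -/
def Sig (L : ℝ) : Set (ℝ × ℝ) := Ioo 0 L ×ˢ {(1 / 2 : ℝ)}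

/-- The density represented through the Bernoulli function:
`H(B,A,q²) = ((γ-1)(B - q²/2)/(Aγ))^{1/(γ-1)}`. -/
def Hd (γ B A q2 : ℝ) : ℝ := ((γ - 1) * (B - q2 / 2) / (A * γ)) ^ (1 / (γ - 1))

/-- Square of the sound speed `c²(ρ,A) = Aγρ^{γ-1}`. -/
def cSq (γ ρ A : ℝ) : ℝ := A * γ * ρ ^ (γ - 1)

/-- Background entropy `A_b = P_b/ρ_b^γ`. -/
def Ab (γ ρb Pb : ℝ) : ℝ := Pb / ρb ^ γ

/-- Background Bernoulli quantity `B_b = u_b²/2 + γP_b/((γ-1)ρ_b)`. -/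
def Bb (γ ρb ub Pb : ℝ) : ℝ := ub ^ 2 / 2 + γ * Pb / ((γ - 1) * ρb)

/-- Background mass flux `J_b = ρ_b u_b`. -/
def Jb (ρb ub : ℝ) : ℝ := ρb * ub

/-- Background Mach number squared `(M_b)² = u_b²/c²(ρ_b, A_b)`. -/
def Mb2 (γ ρb ub Pb : ℝ) : ℝ := ub ^ 2 / cSq γ ρb (Ab γ ρb Pb)

/-- Background inner subsonic state. -/
structure Background (γ ρb ub Pb L α : ℝ) : Prop where
  hγ : 1 < γ
  hρb : 0 < ρb
  hub : 0 < ub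
  hPb : 0 < Pb
  subsonic : ub ^ 2 < γ * Pb / ρb
  normalized : ρb * ub = 2
  hL : 0 < L
  hα : α ∈ Ioo (1 / 2 : ℝ) 1

/-- Entrance data transported to the Lagrangian variable (paper (3-12)). -/
def tData (J0 f : ℝ → ℝ) (y : ℝ) : ℝ := f (Real.sqrt (∫ s in (0:ℝ)..y, 2 * s / J0 s))

/-- Size of the perturbation of the entrance data:
`σ_cd = ‖(J₀,ν₀,A₀,B₀) - (J_b,0,A_b,B_b)‖_{1,α;[0,1/2]}`. -/
def sigmaCD (α γ ρb ub Pb : ℝ) (J0 ν0 A0 B0 : ℝ → ℝ) : ℝ :=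
  hNorm 1 α (Icc (0:ℝ) (1/2)) (fun r => J0 r - Jb ρb ub) +
  hNorm 1 α (Icc (0:ℝ) (1/2)) ν0 +
  hNorm 1 α (Icc (0:ℝ) (1/2)) (fun r => A0 r - Ab γ ρb Pb) +
  hNorm 1 α (Icc (0:ℝ) (1/2)) (fun r => B0 r - Bb γ ρb ub Pb)

/-- `C^{1,α}` distance of two sets of entrance data. -/
def dataDist (α : ℝ) (J0 ν0 A0 B0 J0' ν0' A0' B0' : ℝ → ℝ) : ℝ :=
  hNorm 1 α (Icc (0:ℝ) (1/2)) (fun r => J0 r - J0' r) +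
  hNorm 1 α (Icc (0:ℝ) (1/2)) (fun r => ν0 r - ν0' r) +
  hNorm 1 α (Icc (0:ℝ) (1/2)) (fun r => A0 r - A0' r) +
  hNorm 1 α (Icc (0:ℝ) (1/2)) (fun r => B0 r - B0' r)

/-- `C^{1,α}` regularity of the entrance data. -/
def MemData (α : ℝ) (J0 ν0 A0 B0 : ℝ → ℝ) : Prop :=
  MemH 1 α (Icc (0:ℝ) (1/2)) J0 ∧ MemH 1 α (Icc (0:ℝ) (1/2)) ν0 ∧
  MemH 1 α (Icc (0:ℝ) (1/2)) A0 ∧ MemH 1 α (Icc (0:ℝ) (1/2)) B0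

/-- The density `ρ̂ = H(B̃₀, Ã₀, |u|²)` expressed through the perturbation `W`. -/
def rhoW (γ ub : ℝ) (tA0 tB0 : ℝ → ℝ) (W1 W2 W3 : ℝ × ℝ → ℝ) (p : ℝ × ℝ) : ℝ :=
  Hd γ (tB0 p.2) (tA0 p.2) ((W1 p + ub) ^ 2 + W2 p ^ 2 + W3 p ^ 2)

/-- The modified radius `r̂(y₁,y₂) = (2∫₀^{y₂} 2s/(ρ̂ u_x)(y₁,s) ds)^{1/2}`. -/
def rW (γ ub : ℝ) (tA0 tB0 : ℝ → ℝ) (W1 W2 W3 : ℝ × ℝ → ℝ) (p : ℝ × ℝ) : ℝ :=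
  Real.sqrt (2 * ∫ s in (0:ℝ)..p.2,
    2 * s / (rhoW γ ub tA0 tB0 W1 W2 W3 (p.1, s) * (W1 (p.1, s) + ub)))

/-- `Λ̂(y₂) = (2∫₀^{y₂} 2s/J̃₀(s) ds)^{1/2} ν̃₀(y₂)`. -/
def LamHat (tJ0 tν0 : ℝ → ℝ) (y : ℝ) : ℝ :=
  Real.sqrt (2 * ∫ s in (0:ℝ)..y, 2 * s / tJ0 s) * tν0 y

/-- The swirl velocity `W₃ = Λ̂(y₂)/r̂(y₁,y₂)` determined by the angular momentum. -/
def swirlW (γ ub : ℝ) (tJ0 tν0 tA0 tB0 : ℝ → ℝ) (W1 W2 W3 : ℝ × ℝ → ℝ) (p : ℝ × ℝ) : ℝ :=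
  LamHat tJ0 tν0 p.2 / rW γ ub tA0 tB0 W1 W2 W3 p

/-- Membership in the iteration set `J(δ₁)`. -/
structure InJball (L α δ1 : ℝ) (W1 W2 W3 : ℝ × ℝ → ℝ) : Prop where
  mem1 : MemW 1 α (-α) (Om L) (Sig L) W1
  mem2 : MemW 1 α (-α) (Om L) (Sig L) W2
  mem3 : MemW 1 α (-α) (Om L) (Sig L) W3
  small : wNorm 1 α (-α) (Om L) (Sig L) W1 + wNorm 1 α (-α) (Om L) (Sig L) W2 +
      wNorm 1 α (-α) (Om L) (Sig L) W3 ≤ δ1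
  bc2axis : ∀ y1 : ℝ, W2 (y1, 0) = 0
  bc2exit : ∀ y2 : ℝ, W2 (L, y2) = 0
  bc3axis : ∀ y1 : ℝ, W3 (y1, 0) = 0

/-- The nonlinear interior remainder `F₁(Ŵ,∇Ŵ,Â,B̂)` (paper, Section 4.1). -/
def F1fun (γ ρb ub Pb : ℝ) (tA0 tB0 : ℝ → ℝ) (W1 W2 W3 : ℝ × ℝ → ℝ) (p : ℝ × ℝ) : ℝ :=
  let ρ := rhoW γ ub tA0 tB0 W1 W2 W3 p
  let r := rW γ ub tA0 tB0 W1 W2 W3 p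
  let c2 := cSq γ ρ (tA0 p.2)
  let c2b := cSq γ ρb (Ab γ ρb Pb)
  let Bh := tB0 p.2 - Bb γ ρb ub Pb
  (c2 - (ub + W1 p) ^ 2) * (r * ρ * W2 p / (2 * p.2)) * dr W1 p
  + W2 p ^ 2 * (r * ρ * (ub + W1 p) / (2 * p.2)) * dr W2 p
  - (c2 / r - c2b / p.2) * W2 p
  - ((γ - 1) * Bh - (γ + 1) / 2 * W1 p ^ 2 - (γ - 1) / 2 * W2 p ^ 2
      - (γ - 1) / 2 * W3 p ^ 2 - (γ + 1) * ub * W1 p) * dx W1 p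
  - ((γ - 1) * Bh - (γ - 1) / 2 * W1 p ^ 2 - (γ - 1) / 2 * W2 p ^ 2
      - (γ - 1) / 2 * W3 p ^ 2 - (γ - 1) * ub * W1 p) * dr W2 p
  - W3 p ^ 2 / r * W2 p
  + (W1 p + ub) * W2 p *
      (dx W2 p - r * ρ * W2 p / (2 * p.2) * dr W2 p + r * ρ * (W1 p + ub) / (2 * p.2) * dr W1 p)

/-- The nonlinear interior remainder `F₂(Ŵ,∇Ŵ,Â,B̂)` (paper, Section 4.1). -/
def F2fun (γ ub : ℝ) (tA0 tB0 : ℝ → ℝ) (W1 W2 W3 : ℝ × ℝ → ℝ) (p : ℝ × ℝ) : ℝ :=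
  let ρ := rhoW γ ub tA0 tB0 W1 W2 W3 p
  let r := rW γ ub tA0 tB0 W1 W2 W3 p
  1 / (ub + W1 p) *
    (r * ρ * (W1 p + ub) / (2 * p.2) * W3 p * dr W3 p + W3 p ^ 2 / r
      + r * ρ * (W1 p + ub) / (2 * p.2) * (ρ ^ (γ - 1) / (γ - 1)) * deriv tA0 p.2
      - r * ρ * (W1 p + ub) / (2 * p.2) * deriv tB0 p.2)
  + 1 / (ub + W1 p) * (r * ρ * W2 p / (2 * p.2) * dr W2 p)

/-- The entrance boundary remainder `F₃(Ŵ,Ĵ,Â,B̂)` (paper, Section 4.1). -/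
def F3fun (γ ρb ub Pb : ℝ) (tJ0 tA0 tB0 : ℝ → ℝ) (W1 W2 W3 : ℝ × ℝ → ℝ) (y : ℝ) : ℝ :=
  let M2 := Mb2 γ ρb ub Pb
  let ρhat := rhoW γ ub tA0 tB0 W1 W2 W3 (0, y)
  let ρ0 := Hd γ (Bb γ ρb ub Pb) (Ab γ ρb Pb) (ub ^ 2)
  (tJ0 y - Jb ρb ub) / (ρb * (1 - M2))
  - W1 (0, y) / (ρb * (1 - M2)) * (ρhat - ρ0)
  - ub / (ρb * (1 - M2)) * (ρhat - ρ0 + Jb ρb ub / cSq γ ρb (Ab γ ρb Pb) * W1 (0, y))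

/-- The kinematic boundary term `F₄(Ŵ, g_cd) = (u_b + Ŵ₁) g_cd'` on `Σ`. -/
def F4fun (ub : ℝ) (W1 : ℝ × ℝ → ℝ) (w : ℝ → ℝ) (y1 : ℝ) : ℝ :=
  (ub + W1 (y1, 1/2)) * w y1

/-- The linear boundary value problem (4-6). -/
structure SolvesLinear (L M2 : ℝ) (G1 G2 : ℝ × ℝ → ℝ) (G3 G4 : ℝ → ℝ)
    (W1 W2 : ℝ × ℝ → ℝ) : Prop where
  eq1 : ∀ p ∈ Om L, (1 - M2) * dx W1 p + dr W2 p + W2 p / p.2 = G1 p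
  eq2 : ∀ p ∈ Om L, dx W2 p - dr W1 p = G2 p
  bc0 : ∀ y ∈ Ioo (0:ℝ) (1/2), W1 (0, y) = G3 y
  bcL : ∀ y ∈ Ioo (0:ℝ) (1/2), W2 (L, y) = 0
  bcS : ∀ y1 ∈ Ioo (0:ℝ) L, W2 (y1, 1/2) = G4 y1
  bcA : ∀ y1 ∈ Ioo (0:ℝ) L, W2 (y1, 0) = 0

/-- The density as a function of the Lagrangian velocity components. -/
def rhoU (γ : ℝ) (tA0 tB0 : ℝ → ℝ) (ux ur uθ : ℝ × ℝ → ℝ) (p : ℝ × ℝ) : ℝ :=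
  Hd γ (tB0 p.2) (tA0 p.2) (ux p ^ 2 + ur p ^ 2 + uθ p ^ 2)

/-- The radius as a nonlocal function of the Lagrangian velocity (paper (3-10)). -/
def rU (γ : ℝ) (tA0 tB0 : ℝ → ℝ) (ux ur uθ : ℝ × ℝ → ℝ) (p : ℝ × ℝ) : ℝ :=
  Real.sqrt (2 * ∫ s in (0:ℝ)..p.2, 2 * s / (rhoU γ tA0 tB0 ux ur uθ (p.1, s) * ux (p.1, s)))

/-- First equation of the nonlinear system (3-20). -/
def NLeq1 (γ : ℝ) (tA0 tB0 : ℝ → ℝ) (ux ur uθ : ℝ × ℝ → ℝ) (p : ℝ × ℝ) : Prop :=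
  let ρ := rhoU γ tA0 tB0 ux ur uθ p
  let r := rU γ tA0 tB0 ux ur uθ p
  let c2 := cSq γ ρ (tA0 p.2)
  let Kx := r * ρ * ux p / (2 * p.2)
  let Kr := r * ρ * ur p / (2 * p.2)
  (c2 - ux p ^ 2) * (dx ux p - Kr * dr ux p) + (c2 - ur p ^ 2) * (Kx * dr ur p)
    + c2 / r * ur p + uθ p ^ 2 / r * ur p
    = ux p * ur p * (dx ur p - Kr * dr ur p + Kx * dr ux p)

/-- Second equation of the nonlinear system (3-20). -/
def NLeq2 (γ : ℝ) (tA0 tB0 : ℝ → ℝ) (ux ur uθ : ℝ × ℝ → ℝ) (p : ℝ × ℝ) : Prop :=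
  let ρ := rhoU γ tA0 tB0 ux ur uθ p
  let r := rU γ tA0 tB0 ux ur uθ p
  let Kx := r * ρ * ux p / (2 * p.2)
  let Kr := r * ρ * ur p / (2 * p.2)
  ux p * (dx ur p - Kr * dr ur p - Kx * dr ux p)
    = Kx * uθ p * dr uθ p + uθ p ^ 2 / r + Kx * (ρ ^ (γ - 1) / (γ - 1)) * deriv tA0 p.2
      - Kx * deriv tB0 p.2

/-- Third equation of the nonlinear system (3-20): `∂_{y₁}(r u_θ) = 0`. -/
def NLeq3 (γ : ℝ) (tA0 tB0 : ℝ → ℝ) (ux ur uθ : ℝ × ℝ → ℝ) (p : ℝ × ℝ) : Prop :=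
  fderiv ℝ (fun q => rU γ tA0 tB0 ux ur uθ q * uθ q) p (1, 0) = 0

/-- The nonlinear boundary value problem (3-20)–(3-21). -/
structure SolvesNonlinear (γ L : ℝ) (tJ0 tν0 tA0 tB0 w : ℝ → ℝ)
    (ux ur uθ : ℝ × ℝ → ℝ) : Prop where
  eq1 : ∀ p ∈ Om L, NLeq1 γ tA0 tB0 ux ur uθ p
  eq2 : ∀ p ∈ Om L, NLeq2 γ tA0 tB0 ux ur uθ p
  eq3 : ∀ p ∈ Om L, NLeq3 γ tA0 tB0 ux ur uθ p
  bcJ : ∀ y ∈ Ioo (0:ℝ) (1/2), rhoU γ tA0 tB0 ux ur uθ (0, y) * ux (0, y) = tJ0 y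
  bcν : ∀ y ∈ Ioo (0:ℝ) (1/2), uθ (0, y) = tν0 y
  bcL : ∀ y ∈ Ioo (0:ℝ) (1/2), ur (L, y) = 0
  bcS : ∀ y1 ∈ Ioo (0:ℝ) L, ur (y1, 1/2) = ux (y1, 1/2) * w y1
  bcA : ∀ y1 ∈ Ioo (0:ℝ) L, ur (y1, 0) = 0

/-- The nonlinear problem in perturbation form (5-8), for entrance data `(J₀,ν₀,A₀,B₀)`
and contact discontinuity slope `w`. -/
structure SolvesPert (γ ρb ub Pb L : ℝ) (J0 ν0 A0 B0 w : ℝ → ℝ)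
    (W1 W2 W3 : ℝ × ℝ → ℝ) : Prop where
  swirl : ∀ p ∈ Om L, W3 p =
    swirlW γ ub (tData J0 J0) (tData J0 ν0) (tData J0 A0) (tData J0 B0) W1 W2 W3 p
  lin : SolvesLinear L (Mb2 γ ρb ub Pb)
    (fun p => F1fun γ ρb ub Pb (tData J0 A0) (tData J0 B0) W1 W2 W3 p / cSq γ ρb (Ab γ ρb Pb))
    (F2fun γ ub (tData J0 A0) (tData J0 B0) W1 W2 W3)
    (F3fun γ ρb ub Pb (tData J0 J0) (tData J0 A0) (tData J0 B0) W1 W2 W3)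
    (fun y1 => (ub + W1 (y1, 1/2)) * w y1) W1 W2

/-- The linearized problem (5-15) at `(W, w)` in the direction `w₁`, with solution `Z`. -/
structure SolvesLinearized (γ ρb ub Pb L : ℝ) (J0 ν0 A0 B0 w w1 : ℝ → ℝ)
    (W1 W2 W3 Z1 Z2 Z3 : ℝ × ℝ → ℝ) : Prop where
  swirl : ∀ p ∈ Om L, Z3 p = deriv (fun t : ℝ =>
    swirlW γ ub (tData J0 J0) (tData J0 ν0) (tData J0 A0) (tData J0 B0)
      (fun q => W1 q + t * Z1 q) (fun q => W2 q + t * Z2 q) (fun q => W3 q + t * Z3 q) p) 0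
  eq1 : ∀ p ∈ Om L, (1 - Mb2 γ ρb ub Pb) * dx Z1 p + dr Z2 p + Z2 p / p.2 =
    deriv (fun t : ℝ => F1fun γ ρb ub Pb (tData J0 A0) (tData J0 B0)
      (fun q => W1 q + t * Z1 q) (fun q => W2 q + t * Z2 q) (fun q => W3 q + t * Z3 q) p /
        cSq γ ρb (Ab γ ρb Pb)) 0
  eq2 : ∀ p ∈ Om L, dx Z2 p - dr Z1 p =
    deriv (fun t : ℝ => F2fun γ ub (tData J0 A0) (tData J0 B0)
      (fun q => W1 q + t * Z1 q) (fun q => W2 q + t * Z2 q) (fun q => W3 q + t * Z3 q) p) 0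
  bc0 : ∀ y ∈ Ioo (0:ℝ) (1/2), Z1 (0, y) =
    deriv (fun t : ℝ => F3fun γ ρb ub Pb (tData J0 J0) (tData J0 A0) (tData J0 B0)
      (fun q => W1 q + t * Z1 q) (fun q => W2 q + t * Z2 q) (fun q => W3 q + t * Z3 q) y) 0
  bcL : ∀ y ∈ Ioo (0:ℝ) (1/2), Z2 (L, y) = 0
  bcS : ∀ y1 ∈ Ioo (0:ℝ) L, Z2 (y1, 1/2) = (ub + W1 (y1, 1/2)) * w1 y1 + Z1 (y1, 1/2) * w y1
  bcA : ∀ y1 ∈ Ioo (0:ℝ) L, Z2 (y1, 0) = 0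

/-- The pressure `N(W₁,W₂,W₃,Ã₀,B̃₀) = Ã₀(1/2) ρ(...)^γ` evaluated on `y₂ = 1/2`. -/
def Npress (γ ub : ℝ) (J0 A0 B0 : ℝ → ℝ) (W1 W2 W3 : ℝ × ℝ → ℝ) (y1 : ℝ) : ℝ :=
  tData J0 A0 (1/2) * rhoW γ ub (tData J0 A0) (tData J0 B0) W1 W2 W3 (y1, 1/2) ^ γ

/-- The derivative `D_wQ(φ₀,w)(w₁) = Σ_j ∂_{W_j}N · W_j⁰` along the linearized solution `Z`. -/
def DQfun (γ ub : ℝ) (J0 A0 B0 : ℝ → ℝ) (W1 W2 W3 Z1 Z2 Z3 : ℝ × ℝ → ℝ) (y1 : ℝ) : ℝ :=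
  deriv (fun t : ℝ => Npress γ ub J0 A0 B0 (fun q => W1 q + t * Z1 q)
    (fun q => W2 q + t * Z2 q) (fun q => W3 q + t * Z3 q) y1) 0

/-- The steady axisymmetric Euler system (2-2) at a point `p = (x,r)`, with
entropy `A = P/ρ^γ`. -/
def EulerAx (γ : ℝ) (ρ ux ur uθ P : ℝ × ℝ → ℝ) (p : ℝ × ℝ) : Prop :=
  dx (fun q => ρ q * ux q) p + dr (fun q => ρ q * ur q) p + ρ p * ur p / p.2 = 0 ∧
  ρ p * (ux p * dx ux p + ur p * dr ux p) + dx P p = 0 ∧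
  ρ p * (ux p * dx ur p + ur p * dr ur p) - ρ p * uθ p ^ 2 / p.2 + dr P p = 0 ∧
  ρ p * (ux p * dx (fun q => q.2 * uθ q) p + ur p * dr (fun q => q.2 * uθ q) p) = 0 ∧
  ρ p * (ux p * dx (fun q => P q / ρ q ^ γ) p + ur p * dr (fun q => P q / ρ q ^ γ) p) = 0

/-- The deformation-curl system (3-17) at a point, where the density is
represented through the Bernoulli function. -/
def DCAx (γ : ℝ) (ux ur uθ A B : ℝ × ℝ → ℝ) (p : ℝ × ℝ) : Prop :=
  let q2 := ux p ^ 2 + ur p ^ 2 + uθ p ^ 2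
  let ρ := Hd γ (B p) (A p) q2
  let c2 := cSq γ ρ (A p)
  ((c2 - ux p ^ 2) * dx ux p + (c2 - ur p ^ 2) * dr ur p
      - ux p * ur p * (dx ur p + dr ux p) + ur p * (c2 + uθ p ^ 2) / p.2 = 0) ∧
  (ux p * (dx ur p - dr ux p) = uθ p * dr uθ p + uθ p ^ 2 / p.2
      + (B p - q2 / 2) / (A p * γ) * dr A p - dr B p) ∧
  (ux p * dx (fun q => q.2 * uθ q) p + ur p * dr (fun q => q.2 * uθ q) p = 0) ∧
  (ux p * dx A p + ur p * dr A p = 0) ∧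
  (ux p * dx B p + ur p * dr B p = 0)

/-- Three-dimensional Euclidean space. -/
abbrev E3 := EuclideanSpace ℝ (Fin 3)

/-- Standard basis of `ℝ³`. -/
def e3 : Fin 3 → E3 := fun i => EuclideanSpace.single i 1

/-- Distance to the `x₁`-axis. -/
def R3 (p : E3) : ℝ := Real.sqrt (p 1 ^ 2 + p 2 ^ 2)

/-- A cylindrical function viewed as a function on `ℝ³`. -/
def cyl3 (f : ℝ × ℝ → ℝ) (p : E3) : ℝ := f (p 0, R3 p)

/-- The Cartesian components of the axisymmetric velocity field
`u = u_x e_x + u_r e_r + u_θ e_θ`. -/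
def u3comp (uxc urc uθc : ℝ × ℝ → ℝ) (i : Fin 3) (p : E3) : ℝ :=
  if i = 0 then cyl3 uxc p
  else if i = 1 then cyl3 urc p * (p 1 / R3 p) - cyl3 uθc p * (p 2 / R3 p)
  else cyl3 urc p * (p 2 / R3 p) + cyl3 uθc p * (p 1 / R3 p)

/-- The classical three-dimensional steady full Euler system at the point `p`. -/
def Euler3Classical (γ : ℝ) (ρ3 P3 : E3 → ℝ) (u3 : Fin 3 → E3 → ℝ) (p : E3) : Prop :=
  (∑ i, fderiv ℝ (fun q => ρ3 q * u3 i q) p (e3 i)) = 0 ∧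
  (∀ j, (∑ i, fderiv ℝ (fun q => ρ3 q * u3 i q * u3 j q) p (e3 i)) +
    fderiv ℝ P3 p (e3 j) = 0) ∧
  (∑ i, fderiv ℝ (fun q => ρ3 q * u3 i q * ((∑ j, u3 j q ^ 2) / 2 + P3 q / ((γ - 1) * ρ3 q))
      + u3 i q * P3 q) p (e3 i)) = 0

end ContactDisc

namespace ContactDisc

/-! ### An auxiliary family of weighted `C^{1,α}` classes -/

/-- The affine weight `1/2 - k y₂` (`k = 1`: distance to `Σ`; `k = 0`: constant weight). -/
def wt (k : ℝ) (p : ℝ × ℝ) : ℝ := 1 / 2 - k * p.2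

/-- `f` has weighted `C^{1,α}` norms bounded by `M`. -/
structure Nice (L α k M : ℝ) (f : ℝ × ℝ → ℝ) : Prop where
  diff : ∀ p ∈ Om L, DifferentiableAt ℝ f p
  b0 : ∀ p ∈ Om L, |f p| ≤ M
  b1 : ∀ p ∈ Om L, ∀ d : ℝ, 0 < d → d ≤ wt k p → d ^ (1 - α) * ‖fderiv ℝ f p‖ ≤ M
  b2 : ∀ p ∈ Om L, ∀ q ∈ Om L, ∀ d : ℝ, 0 < d → d ≤ wt k p → d ≤ wt k q →
    d * ‖fderiv ℝ f p - fderiv ℝ f q‖ ≤ M * ‖p - q‖ ^ α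

lemma isOpen_Om (L : ℝ) : IsOpen (Om L) := isOpen_Ioo.prod isOpen_Ioo

lemma convex_Om (L : ℝ) : Convex ℝ (Om L) := (convex_Ioo _ _).prod (convex_Ioo _ _)

lemma wt_le {L k : ℝ} (hk : k ∈ Icc (0 : ℝ) 1) {p : ℝ × ℝ} (hp : p ∈ Om L) :
    wt k p ≤ 1 / 2 := by
  have := hp.2.1
  have := mul_nonneg hk.1 this.le
  unfold wt; linarith

lemma wt_pos {L k : ℝ} (hk : k ∈ Icc (0 : ℝ) 1) {p : ℝ × ℝ} (hp : p ∈ Om L) :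
    0 < wt k p := by
  have h1 := hp.2.1
  have h2 := hp.2.2
  have h3 := mul_le_mul_of_nonneg_right hk.2 h1.le
  unfold wt; linarith

lemma Nice.of_hasFDerivAt {L α k M : ℝ} {f : ℝ × ℝ → ℝ} {f' : ℝ × ℝ → (ℝ × ℝ →L[ℝ] ℝ)}
    (h : ∀ p ∈ Om L, HasFDerivAt f (f' p) p)
    (b0 : ∀ p ∈ Om L, |f p| ≤ M)
    (b1 : ∀ p ∈ Om L, ∀ d : ℝ, 0 < d → d ≤ wt k p → d ^ (1 - α) * ‖f' p‖ ≤ M)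
    (b2 : ∀ p ∈ Om L, ∀ q ∈ Om L, ∀ d : ℝ, 0 < d → d ≤ wt k p → d ≤ wt k q →
      d * ‖f' p - f' q‖ ≤ M * ‖p - q‖ ^ α) : Nice L α k M f where
  diff p hp := (h p hp).differentiableAt
  b0 := b0
  b1 p hp d hd hdp := by rw [(h p hp).fderiv]; exact b1 p hp d hd hdp
  b2 p hp q hq d hd hdp hdq := by
    rw [(h p hp).fderiv, (h q hq).fderiv]; exact b2 p hp q hq d hd hdp hdq

lemma Nice.congr {L α k M : ℝ} {f g : ℝ × ℝ → ℝ} (hf : Nice L α k M f)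
    (hfg : ∀ p ∈ Om L, g p = f p) : Nice L α k M g := by
  refine Nice.of_hasFDerivAt (f' := fderiv ℝ f) ?_ ?_ hf.b1 hf.b2
  · intro p hp
    refine (hf.diff p hp).hasFDerivAt.congr_of_eventuallyEq ?_
    filter_upwards [(isOpen_Om L).mem_nhds hp] with q hq using hfg q hq
  · intro p hp; rw [hfg p hp]; exact hf.b0 p hp

lemma Nice.mono {L α k M N : ℝ} {f : ℝ × ℝ → ℝ} (hf : Nice L α k M f) (h : M ≤ N) :
    Nice L α k N f where
  diff := hf.diff
  b0 p hp := (hf.b0 p hp).trans h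
  b1 p hp d hd hdp := (hf.b1 p hp d hd hdp).trans h
  b2 p hp q hq d hd hdp hdq := (hf.b2 p hp q hq d hd hdp hdq).trans (by gcongr)

lemma Nice.zero_one {L α M : ℝ} {f : ℝ × ℝ → ℝ} (hf : Nice L α 0 M f) :
    Nice L α 1 M f := by
  have key : ∀ p ∈ Om L, wt 1 p ≤ wt 0 p := by
    intro p hp
    have := hp.2.1
    unfold wt; linarith
  exact ⟨hf.diff, hf.b0, fun p hp d hd h => hf.b1 p hp d hd (h.trans (key p hp)),
    fun p hp q hq d hd h h' => hf.b2 p hp q hq d hd (h.trans (key p hp)) (h'.trans (key q hq))⟩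

lemma Nice.nonneg {L α k M : ℝ} {f : ℝ × ℝ → ℝ} (hf : Nice L α k M f) {p : ℝ × ℝ}
    (hp : p ∈ Om L) : 0 ≤ M := (abs_nonneg _).trans (hf.b0 p hp)

/-- Lipschitz bound away from `Σ`. -/
lemma Nice.lip {L α k M : ℝ} {f : ℝ × ℝ → ℝ} (hf : Nice L α k M f)
    {p q : ℝ × ℝ} (hp : p ∈ Om L) (hq : q ∈ Om L) {d : ℝ} (hd : 0 < d)
    (hdp : d ≤ wt k p) (hdq : d ≤ wt k q) :
    d ^ (1 - α) * |f p - f q| ≤ M * ‖p - q‖ := by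
  have hd' : 0 < d ^ (1 - α) := Real.rpow_pos_of_pos hd _
  have hconv : Convex ℝ (Om L ∩ {x | d ≤ wt k x}) := by
    refine (convex_Om L).inter ?_
    have : {x : ℝ × ℝ | d ≤ wt k x} = {x | k * x.2 ≤ 1 / 2 - d} := by
      ext x; simp only [mem_ofPred_eq, wt]; constructor <;> intro h <;> linarith
    rw [this]
    refine convex_halfSpace_le (f := fun x : ℝ × ℝ => k * x.2) ⟨?_, ?_⟩ _
    · intro x y; simp [mul_add]
    · intro c x; simp; ring
  have := Convex.norm_image_sub_le_of_norm_fderiv_le (𝕜 := ℝ) (f := f)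
    (C := M / d ^ (1 - α)) (s := Om L ∩ {x | d ≤ wt k x}) (x := q) (y := p)
    (fun x hx => hf.diff x hx.1)
    (fun x hx => by
      rw [le_div_iff₀ hd', mul_comm]; exact hf.b1 x hx.1 d hd hx.2) hconv ⟨hq, hdq⟩ ⟨hp, hdp⟩
  rw [Real.norm_eq_abs] at this
  calc d ^ (1 - α) * |f p - f q| ≤ d ^ (1 - α) * (M / d ^ (1 - α) * ‖p - q‖) := by gcongr
    _ = M * ‖p - q‖ := by field_simp

/-- Weighted Hölder bound of the function itself. -/
lemma Nice.osc {L α k M : ℝ} (hα : α ∈ Ioo (1 / 2 : ℝ) 1) (hk : k ∈ Icc (0 : ℝ) 1)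
    {f : ℝ × ℝ → ℝ} (hf : Nice L α k M f)
    {p q : ℝ × ℝ} (hp : p ∈ Om L) (hq : q ∈ Om L) {d : ℝ} (hd : 0 < d)
    (hdp : d ≤ wt k p) (hdq : d ≤ wt k q) :
    d ^ α * |f p - f q| ≤ 2 * M * ‖p - q‖ ^ α := by
  have hM := hf.nonneg hp
  have hα0 : 0 < α := by linarith [hα.1]
  have hα1 : 0 < 1 - α := by linarith [hα.2]
  have hd1 : d ≤ 1 := by linarith [wt_le hk hp]
  rcases le_total ‖p - q‖ d with h | h
  · have h1 := hf.lip hp hq hd hdp hdq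
    have hd' : 0 < d ^ (1 - α) := Real.rpow_pos_of_pos hd _
    have h2 : ‖p - q‖ ≤ ‖p - q‖ ^ α * d ^ (1 - α) := by
      calc ‖p - q‖ = ‖p - q‖ ^ (α + (1 - α)) := by simp
        _ = ‖p - q‖ ^ α * ‖p - q‖ ^ (1 - α) :=
          Real.rpow_add_of_nonneg (norm_nonneg _) hα0.le hα1.le
        _ ≤ _ := by gcongr
    have h3 : |f p - f q| ≤ M * ‖p - q‖ ^ α := by
      have : d ^ (1 - α) * |f p - f q| ≤ d ^ (1 - α) * (M * ‖p - q‖ ^ α) := by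
        calc _ ≤ M * ‖p - q‖ := h1
          _ ≤ M * (‖p - q‖ ^ α * d ^ (1 - α)) := by gcongr
          _ = _ := by ring
      exact le_of_mul_le_mul_left this hd'
    have h4 : d ^ α ≤ 1 := Real.rpow_le_one hd.le hd1 hα0.le
    have h5 : 0 ≤ M * ‖p - q‖ ^ α := by positivity
    calc d ^ α * |f p - f q| ≤ 1 * (M * ‖p - q‖ ^ α) := by gcongr
      _ ≤ _ := by linarith
  · have h1 : |f p - f q| ≤ 2 * M := by
      have := abs_sub (f p) (f q)
      linarith [hf.b0 p hp, hf.b0 q hq]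
    calc d ^ α * |f p - f q| ≤ ‖p - q‖ ^ α * (2 * M) := by gcongr
      _ = _ := by ring

/-- Multiplying the gradient of a nice function by a Hölder coefficient. -/
lemma Nice.coef {L α k N A : ℝ} (hα : α ∈ Ioo (1 / 2 : ℝ) 1)
    {g : ℝ × ℝ → ℝ} (hg : Nice L α k N g)
    {p q : ℝ × ℝ} (hp : p ∈ Om L) (hq : q ∈ Om L) {d : ℝ} (hd : 0 < d)
    (hdp : d ≤ wt k p) (hdq : d ≤ wt k q) {a b : ℝ} (ha : |a| ≤ A)
    (hab : d ^ α * |a - b| ≤ A * ‖p - q‖ ^ α) :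
    d * ‖a • fderiv ℝ g p - b • fderiv ℝ g q‖ ≤ 2 * A * N * ‖p - q‖ ^ α := by
  have hN := hg.nonneg hp
  have hA : 0 ≤ A := (abs_nonneg _).trans ha
  have e : a • fderiv ℝ g p - b • fderiv ℝ g q
      = a • (fderiv ℝ g p - fderiv ℝ g q) + (a - b) • fderiv ℝ g q := by
    ext
    all_goals simp
    all_goals ring
  have h1 := hg.b2 p hp q hq d hd hdp hdq
  have h2 := hg.b1 q hq d hd hdq
  have hdd : d = d ^ α * d ^ (1 - α) := by rw [← Real.rpow_add hd]; simp
  have t1 : d * ‖a • (fderiv ℝ g p - fderiv ℝ g q)‖ ≤ A * (N * ‖p - q‖ ^ α) := by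
    rw [norm_smul, Real.norm_eq_abs]
    calc d * (|a| * ‖fderiv ℝ g p - fderiv ℝ g q‖)
        = |a| * (d * ‖fderiv ℝ g p - fderiv ℝ g q‖) := by ring
      _ ≤ _ := by gcongr
  have t2 : d * ‖(a - b) • fderiv ℝ g q‖ ≤ (A * ‖p - q‖ ^ α) * N := by
    rw [norm_smul, Real.norm_eq_abs]
    calc d * (|a - b| * ‖fderiv ℝ g q‖)
        = (d ^ α * d ^ (1 - α)) * (|a - b| * ‖fderiv ℝ g q‖) := by rw [← hdd]
      _ = (d ^ α * |a - b|) * (d ^ (1 - α) * ‖fderiv ℝ g q‖) := by ring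
      _ ≤ _ := by gcongr
  rw [e]
  calc d * ‖a • (fderiv ℝ g p - fderiv ℝ g q) + (a - b) • fderiv ℝ g q‖
      ≤ d * (‖a • (fderiv ℝ g p - fderiv ℝ g q)‖ + ‖(a - b) • fderiv ℝ g q‖) := by
        gcongr; exact norm_add_le _ _
    _ = d * ‖a • (fderiv ℝ g p - fderiv ℝ g q)‖ + d * ‖(a - b) • fderiv ℝ g q‖ := by ring
    _ ≤ _ := by linarith

lemma Nice.coef1 {L α k N A : ℝ} {g : ℝ × ℝ → ℝ} (hg : Nice L α k N g)
    {p : ℝ × ℝ} (hp : p ∈ Om L) {d : ℝ} (hd : 0 < d)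
    (hdp : d ≤ wt k p) {a : ℝ} (ha : |a| ≤ A) :
    d ^ (1 - α) * ‖a • fderiv ℝ g p‖ ≤ A * N := by
  have hA : 0 ≤ A := (abs_nonneg _).trans ha
  rw [norm_smul, Real.norm_eq_abs]
  calc d ^ (1 - α) * (|a| * ‖fderiv ℝ g p‖) = |a| * (d ^ (1 - α) * ‖fderiv ℝ g p‖) := by ring
    _ ≤ _ := by
      have := hg.b1 p hp d hd hdp
      gcongr

lemma Nice.const {L α k : ℝ} (c : ℝ) : Nice L α k |c| (fun _ => c) := by
  refine Nice.of_hasFDerivAt (f' := fun _ => 0) (fun p _ => hasFDerivAt_const c p)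
    (fun _ _ => le_rfl) ?_ ?_
  · intros; simp
  · intros; simp; positivity

lemma Nice.add {L α k M N : ℝ} {f g : ℝ × ℝ → ℝ} (hf : Nice L α k M f)
    (hg : Nice L α k N g) : Nice L α k (M + N) (fun p => f p + g p) := by
  refine Nice.of_hasFDerivAt (f' := fun p => fderiv ℝ f p + fderiv ℝ g p)
    (fun p hp => (hf.diff p hp).hasFDerivAt.add (hg.diff p hp).hasFDerivAt) ?_ ?_ ?_
  · intro p hp
    exact (abs_add_le _ _).trans (add_le_add (hf.b0 p hp) (hg.b0 p hp))
  · intro p hp d hd hdp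
    calc d ^ (1 - α) * ‖fderiv ℝ f p + fderiv ℝ g p‖
        ≤ d ^ (1 - α) * (‖fderiv ℝ f p‖ + ‖fderiv ℝ g p‖) := by gcongr; exact norm_add_le _ _
      _ = d ^ (1 - α) * ‖fderiv ℝ f p‖ + d ^ (1 - α) * ‖fderiv ℝ g p‖ := by ring
      _ ≤ _ := add_le_add (hf.b1 p hp d hd hdp) (hg.b1 p hp d hd hdp)
  · intro p hp q hq d hd hdp hdq
    have e : fderiv ℝ f p + fderiv ℝ g p - (fderiv ℝ f q + fderiv ℝ g q)
      = (fderiv ℝ f p - fderiv ℝ f q) + (fderiv ℝ g p - fderiv ℝ g q) := by abel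
    rw [e]
    calc d * ‖(fderiv ℝ f p - fderiv ℝ f q) + (fderiv ℝ g p - fderiv ℝ g q)‖
        ≤ d * (‖fderiv ℝ f p - fderiv ℝ f q‖ + ‖fderiv ℝ g p - fderiv ℝ g q‖) := by
          gcongr; exact norm_add_le _ _
      _ = d * ‖fderiv ℝ f p - fderiv ℝ f q‖ + d * ‖fderiv ℝ g p - fderiv ℝ g q‖ := by ring
      _ ≤ M * ‖p - q‖ ^ α + N * ‖p - q‖ ^ α :=
        add_le_add (hf.b2 p hp q hq d hd hdp hdq) (hg.b2 p hp q hq d hd hdp hdq)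
      _ = _ := by ring

lemma Nice.mul {L α k M N : ℝ} (hα : α ∈ Ioo (1 / 2 : ℝ) 1) (hk : k ∈ Icc (0 : ℝ) 1)
    {f g : ℝ × ℝ → ℝ} (hf : Nice L α k M f)
    (hg : Nice L α k N g) : Nice L α k (8 * M * N) (fun p => f p * g p) := by
  refine Nice.of_hasFDerivAt (f' := fun p => f p • fderiv ℝ g p + g p • fderiv ℝ f p)
    (fun p hp => (hf.diff p hp).hasFDerivAt.mul (hg.diff p hp).hasFDerivAt) ?_ ?_ ?_
  · intro p hp
    have hM := hf.nonneg hp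
    have hN := hg.nonneg hp
    rw [abs_mul]
    have : |f p| * |g p| ≤ M * N := mul_le_mul (hf.b0 p hp) (hg.b0 p hp) (abs_nonneg _) hM
    nlinarith [mul_nonneg hM hN]
  · intro p hp d hd hdp
    have hM := hf.nonneg hp
    have hN := hg.nonneg hp
    calc d ^ (1 - α) * ‖f p • fderiv ℝ g p + g p • fderiv ℝ f p‖
        ≤ d ^ (1 - α) * (‖f p • fderiv ℝ g p‖ + ‖g p • fderiv ℝ f p‖) := by
          gcongr; exact norm_add_le _ _
      _ = d ^ (1 - α) * ‖f p • fderiv ℝ g p‖ + d ^ (1 - α) * ‖g p • fderiv ℝ f p‖ := by ring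
      _ ≤ M * N + N * M := add_le_add (hg.coef1 hp hd hdp (hf.b0 p hp))
          (hf.coef1 hp hd hdp (hg.b0 p hp))
      _ ≤ _ := by nlinarith [mul_nonneg hM hN]
  · intro p hp q hq d hd hdp hdq
    have hM := hf.nonneg hp
    have hN := hg.nonneg hp
    have e : f p • fderiv ℝ g p + g p • fderiv ℝ f p - (f q • fderiv ℝ g q + g q • fderiv ℝ f q)
      = (f p • fderiv ℝ g p - f q • fderiv ℝ g q)
        + (g p • fderiv ℝ f p - g q • fderiv ℝ f q) := by abel
    have t1 := hg.coef (A := 2 * M) hα hp hq hd hdp hdq (a := f p) (b := f q)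
      ((hf.b0 p hp).trans (by linarith)) (hf.osc hα hk hp hq hd hdp hdq)
    have t2 := hf.coef (A := 2 * N) hα hp hq hd hdp hdq (a := g p) (b := g q)
      ((hg.b0 p hp).trans (by linarith)) (hg.osc hα hk hp hq hd hdp hdq)
    rw [e]
    calc d * ‖(f p • fderiv ℝ g p - f q • fderiv ℝ g q)
        + (g p • fderiv ℝ f p - g q • fderiv ℝ f q)‖
        ≤ d * (‖f p • fderiv ℝ g p - f q • fderiv ℝ g q‖
          + ‖g p • fderiv ℝ f p - g q • fderiv ℝ f q‖) := by
          gcongr; exact norm_add_le _ _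
      _ = d * ‖f p • fderiv ℝ g p - f q • fderiv ℝ g q‖
          + d * ‖g p • fderiv ℝ f p - g q • fderiv ℝ f q‖ := by ring
      _ ≤ _ := by linarith

/-- Composition with a scalar function whose derivative along `f` is Hölder. -/
lemma Nice.comp_aux {L α k M K A : ℝ} (hα : α ∈ Ioo (1 / 2 : ℝ) 1)
    {f : ℝ × ℝ → ℝ} (hf : Nice L α k M f) {φ φ' : ℝ → ℝ}
    (hφ : ∀ p ∈ Om L, HasDerivAt φ (φ' (f p)) (f p))
    (h0 : ∀ p ∈ Om L, |φ (f p)| ≤ K)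
    (h1 : ∀ p ∈ Om L, |φ' (f p)| ≤ A)
    (h2 : ∀ p ∈ Om L, ∀ q ∈ Om L, ∀ d : ℝ, 0 < d → d ≤ wt k p → d ≤ wt k q →
      d ^ α * |φ' (f p) - φ' (f q)| ≤ A * ‖p - q‖ ^ α) :
    Nice L α k (K + 2 * A * M) (fun p => φ (f p)) := by
  refine Nice.of_hasFDerivAt (f' := fun p => φ' (f p) • fderiv ℝ f p)
    (fun p hp => (hφ p hp).comp_hasFDerivAt p (hf.diff p hp).hasFDerivAt) ?_ ?_ ?_
  · intro p hp
    have hM := hf.nonneg hp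
    have hA : 0 ≤ A := (abs_nonneg _).trans (h1 p hp)
    have := mul_nonneg hA hM
    linarith [h0 p hp]
  · intro p hp d hd hdp
    have hM := hf.nonneg hp
    have hA : 0 ≤ A := (abs_nonneg _).trans (h1 p hp)
    have hK : 0 ≤ K := (abs_nonneg _).trans (h0 p hp)
    have := mul_nonneg hA hM
    linarith [hf.coef1 hp hd hdp (h1 p hp)]
  · intro p hp q hq d hd hdp hdq
    have hK : 0 ≤ K := (abs_nonneg _).trans (h0 p hp)
    have := hf.coef hα hp hq hd hdp hdq (h1 p hp) (h2 p hp q hq d hd hdp hdq)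
    have h3 : 0 ≤ K * ‖p - q‖ ^ α := by positivity
    linarith

/-- Real powers of nice functions with values in a compact subset of `(0,∞)`. -/
lemma Nice.rpow {α k : ℝ} (hα : α ∈ Ioo (1 / 2 : ℝ) 1) (hk : k ∈ Icc (0 : ℝ) 1)
    (M a b e : ℝ) (ha : 0 < a) : ∃ M' : ℝ, ∀ (L : ℝ) (f : ℝ × ℝ → ℝ), Nice L α k M f →
      (∀ p ∈ Om L, f p ∈ Icc a b) → Nice L α k M' (fun p => f p ^ e) := by
  have hpos : ∀ x ∈ Icc a b, x ≠ 0 := fun x hx => (ha.trans_le hx.1).ne'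
  have hc : ∀ e' : ℝ, ∃ K, ∀ x ∈ Icc a b, |x ^ e'| ≤ K := by
    intro e'
    have : ContinuousOn (fun x : ℝ => x ^ e') (Icc a b) :=
      ContinuousOn.rpow_const continuousOn_id (fun x hx => Or.inl (hpos x hx))
    obtain ⟨K, hK⟩ := isCompact_Icc.exists_bound_of_continuousOn this
    exact ⟨K, fun x hx => by simpa using hK x hx⟩
  obtain ⟨K0, hK0⟩ := hc e
  obtain ⟨K1, hK1⟩ := hc (e - 1)
  obtain ⟨K2, hK2⟩ := hc (e - 1 - 1)
  have hlip : ∀ x ∈ Icc a b, ∀ y ∈ Icc a b, |x ^ (e - 1) - y ^ (e - 1)|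
      ≤ (|e - 1| * K2) * |x - y| := by
    intro x hx y hy
    have := Convex.norm_image_sub_le_of_norm_hasDerivWithin_le (𝕜 := ℝ)
      (f := fun x : ℝ => x ^ (e - 1)) (f' := fun x => (e - 1) * x ^ (e - 1 - 1))
      (s := Icc a b) (C := |e - 1| * K2) (x := y) (y := x)
      (fun z hz => (Real.hasDerivAt_rpow_const (Or.inl (hpos z hz))).hasDerivWithinAt)
      (fun z hz => by
        rw [norm_mul, Real.norm_eq_abs, Real.norm_eq_abs]
        gcongr; exact hK2 z hz) (convex_Icc a b) hy hx
    simpa using this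
  refine ⟨|K0| + 2 * (|e| * |K1| + |e| * (|e - 1| * |K2|) * (2 * |M|)) * |M|, ?_⟩
  intro L f hf hr
  have hf' := hf.mono (le_abs_self M)
  refine Nice.comp_aux (φ := fun x => x ^ e) (φ' := fun x => e * x ^ (e - 1)) hα hf' ?_ ?_ ?_ ?_
  · intro p hp
    exact Real.hasDerivAt_rpow_const (Or.inl (hpos _ (hr p hp)))
  · intro p hp
    exact (hK0 _ (hr p hp)).trans (le_abs_self _)
  · intro p hp
    rw [abs_mul]
    have h1 := (hK1 _ (hr p hp)).trans (le_abs_self _)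
    have h2 : 0 ≤ |e| * (|e - 1| * |K2|) * (2 * |M|) := by positivity
    have h3 : |e| * |f p ^ (e - 1)| ≤ |e| * |K1| := by gcongr
    linarith
  · intro p hp q hq d hd hdp hdq
    have h1 := hf'.osc hα hk hp hq hd hdp hdq
    have h2 := hlip _ (hr p hp) _ (hr q hq)
    have h3 : |e - 1| * K2 * |f p - f q| ≤ |e - 1| * |K2| * |f p - f q| := by
      gcongr; exact le_abs_self _
    have h4 : e * f p ^ (e - 1) - e * f q ^ (e - 1) = e * (f p ^ (e - 1) - f q ^ (e - 1)) := by
      ring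
    have h5 : 0 ≤ |e| * |K1| * ‖p - q‖ ^ α := by positivity
    calc d ^ α * |e * f p ^ (e - 1) - e * f q ^ (e - 1)|
        = d ^ α * (|e| * |f p ^ (e - 1) - f q ^ (e - 1)|) := by rw [h4, abs_mul]
      _ ≤ d ^ α * (|e| * (|e - 1| * |K2| * |f p - f q|)) := by
          gcongr; exact h2.trans h3
      _ = |e| * (|e - 1| * |K2|) * (d ^ α * |f p - f q|) := by ring
      _ ≤ |e| * (|e - 1| * |K2|) * (2 * |M| * ‖p - q‖ ^ α) := by gcongr
      _ ≤ _ := by linarith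

/-- One-dimensional `C^{1,α}` bounds on `(0,1/2)`. -/
structure H1 (α K : ℝ) (φ : ℝ → ℝ) : Prop where
  diff : ∀ x ∈ Ioo (0 : ℝ) (1 / 2), DifferentiableAt ℝ φ x
  b0 : ∀ x ∈ Ioo (0 : ℝ) (1 / 2), |φ x| ≤ K
  b1 : ∀ x ∈ Ioo (0 : ℝ) (1 / 2), |deriv φ x| ≤ K
  b2 : ∀ x ∈ Ioo (0 : ℝ) (1 / 2), ∀ y ∈ Ioo (0 : ℝ) (1 / 2),
    |deriv φ x - deriv φ y| ≤ K * |x - y| ^ α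

/-- Composition of a `C^{1,α}` function with a Lipschitz nice function. -/
lemma Nice.comp_H1 {L α M K : ℝ} (hα : α ∈ Ioo (1 / 2 : ℝ) 1) (hM : 1 ≤ M)
    {f : ℝ × ℝ → ℝ} (hf : Nice L α 0 M f) (hr : ∀ p ∈ Om L, f p ∈ Ioo (0 : ℝ) (1 / 2))
    {φ : ℝ → ℝ} (hφ : H1 α K φ) :
    Nice L α 0 (K * (1 + 4 * M * M)) (fun p => φ (f p)) := by
  have hα0 : 0 < α := by linarith [hα.1]
  have hα1 : 0 < 1 - α := by linarith [hα.2]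
  have hk : (0 : ℝ) ∈ Icc (0 : ℝ) 1 := ⟨le_rfl, zero_le_one⟩
  have := Nice.comp_aux (φ := φ) (φ' := deriv φ) (K := K) (A := K * (2 * M)) hα hf ?_ ?_ ?_ ?_
  · refine this.mono (le_of_eq ?_); ring
  · intro p hp; exact (hφ.diff _ (hr p hp)).hasDerivAt
  · intro p hp; exact hφ.b0 _ (hr p hp)
  · intro p hp
    have h := hφ.b1 _ (hr p hp)
    have hK : 0 ≤ K := (abs_nonneg _).trans h
    nlinarith
  · intro p hp q hq d hd hdp hdq
    have h := hφ.b2 _ (hr p hp) _ (hr q hq)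
    have hK : 0 ≤ K := (abs_nonneg _).trans (hφ.b0 _ (hr p hp))
    have hd1 : d ≤ 1 := by linarith [wt_le hk hp]
    have h4 : d ^ α ≤ 1 := Real.rpow_le_one hd.le hd1 hα0.le
    have hl := hf.lip (d := 1 / 2) hp hq (by norm_num) (by simp [wt]) (by simp [wt])
    have h5 : (1 / 2 : ℝ) ≤ (1 / 2 : ℝ) ^ (1 - α) := by
      calc (1 / 2 : ℝ) = (1 / 2 : ℝ) ^ (1 : ℝ) := by simp
        _ ≤ _ := Real.rpow_le_rpow_of_exponent_ge (by norm_num) (by norm_num) (by linarith)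
    have h6 : |f p - f q| ≤ 2 * M * ‖p - q‖ := by
      have : (1 / 2 : ℝ) * |f p - f q| ≤ (1 / 2 : ℝ) ^ (1 - α) * |f p - f q| := by gcongr
      linarith
    have h7 : |f p - f q| ^ α ≤ 2 * M * ‖p - q‖ ^ α := by
      calc |f p - f q| ^ α ≤ (2 * M * ‖p - q‖) ^ α := by gcongr
        _ = (2 * M) ^ α * ‖p - q‖ ^ α := Real.mul_rpow (by positivity) (norm_nonneg _)
        _ ≤ (2 * M) ^ (1 : ℝ) * ‖p - q‖ ^ α := by
          gcongr
          · linarith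
          · exact hα.2.le
        _ = _ := by simp
    calc d ^ α * |deriv φ (f p) - deriv φ (f q)| ≤ 1 * (K * |f p - f q| ^ α) := by gcongr
      _ ≤ K * (2 * M * ‖p - q‖ ^ α) := by rw [one_mul]; gcongr
      _ = _ := by ring

lemma Nice.snd {L α : ℝ} (hα : α ∈ Ioo (1 / 2 : ℝ) 1) : Nice L α 0 1 (fun p => p.2) := by
  have hα1 : 0 < 1 - α := by linarith [hα.2]
  have hk : (0 : ℝ) ∈ Icc (0 : ℝ) 1 := ⟨le_rfl, zero_le_one⟩
  refine Nice.of_hasFDerivAt (f' := fun _ => ContinuousLinearMap.snd ℝ ℝ ℝ)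
    (fun p _ => hasFDerivAt_snd) ?_ ?_ ?_
  · intro p hp
    rw [abs_of_pos hp.2.1]; linarith [hp.2.2]
  · intro p hp d hd hdp
    have hd1 : d ≤ 1 := by linarith [wt_le hk hp]
    have h4 : d ^ (1 - α) ≤ 1 := Real.rpow_le_one hd.le hd1 hα1.le
    have := ContinuousLinearMap.norm_snd_le ℝ ℝ ℝ
    calc d ^ (1 - α) * ‖ContinuousLinearMap.snd ℝ ℝ ℝ‖ ≤ 1 * 1 := by gcongr
      _ = 1 := by simp
  · intros; simp; positivity

/-! ### The averaging operator -/

/-- The contraction `(y₁,y₂) ↦ (y₁, t y₂)`. -/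
def Sm (t : ℝ) : ℝ × ℝ →L[ℝ] ℝ × ℝ :=
  (ContinuousLinearMap.inl ℝ ℝ ℝ).comp (ContinuousLinearMap.fst ℝ ℝ ℝ) +
    t • (ContinuousLinearMap.inr ℝ ℝ ℝ).comp (ContinuousLinearMap.snd ℝ ℝ ℝ)

lemma Sm_apply (t : ℝ) (p : ℝ × ℝ) : Sm t p = (p.1, t * p.2) := by
  simp [Sm]

lemma continuous_Sm : Continuous Sm := by
  unfold Sm; fun_prop

lemma norm_Sm_le {t : ℝ} (ht : t ∈ Icc (0 : ℝ) 1) : ‖Sm t‖ ≤ 1 := by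
  refine ContinuousLinearMap.opNorm_le_bound _ zero_le_one (fun p => ?_)
  rw [Sm_apply, one_mul, Prod.norm_def, Prod.norm_def]
  refine max_le_max le_rfl ?_
  simp only [norm_mul, Real.norm_eq_abs, abs_of_nonneg ht.1]
  exact mul_le_of_le_one_left (abs_nonneg _) ht.2

lemma Sm_mem {L t : ℝ} (ht : t ∈ Ioc (0 : ℝ) 1) {p : ℝ × ℝ} (hp : p ∈ Om L) :
    Sm t p ∈ Om L := by
  rw [Sm_apply]
  refine ⟨hp.1, mul_pos ht.1 hp.2.1, ?_⟩
  exact (mul_le_of_le_one_left hp.2.1.le ht.2).trans_lt hp.2.2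

lemma wt_Sm {L t k : ℝ} (hk : k ∈ Icc (0 : ℝ) 1) (ht : t ∈ Ioc (0 : ℝ) 1) {p : ℝ × ℝ}
    (hp : p ∈ Om L) : wt k p ≤ wt k (Sm t p) := by
  rw [Sm_apply]
  unfold wt
  have := mul_le_of_le_one_left hp.2.1.le ht.2
  have := mul_le_mul_of_nonneg_left this hk.1
  simp only
  linarith

/-- Weighted average `∫₀¹ 2t f(y₁, t y₂) dt`. -/
def mean (f : ℝ × ℝ → ℝ) (p : ℝ × ℝ) : ℝ := ∫ t in (0 : ℝ)..1, 2 * t * f (Sm t p)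

lemma integral_eq_mean (g : ℝ × ℝ → ℝ) (p : ℝ × ℝ) :
    ∫ s in (0 : ℝ)..p.2, 2 * s * g (p.1, s) = p.2 ^ 2 * mean g p := by
  have h := intervalIntegral.smul_integral_comp_mul_left (a := 0) (b := 1)
    (fun s => 2 * s * g (p.1, s)) p.2
  simp only [mul_zero, mul_one] at h
  rw [← h, smul_eq_mul, pow_two, mul_assoc]
  congr 1
  unfold mean
  rw [← intervalIntegral.integral_const_mul]
  refine intervalIntegral.integral_congr (fun t _ => ?_)
  simp only [Sm_apply]
  rw [mul_comm t p.2]; ring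

lemma Nice.continuousOn {L α k M : ℝ} {f : ℝ × ℝ → ℝ} (hf : Nice L α k M f) :
    ContinuousOn f (Om L) := fun p hp => (hf.diff p hp).continuousAt.continuousWithinAt

lemma continuous_wt (k : ℝ) : Continuous (wt k) := by unfold wt; fun_prop

lemma Nice.continuousOn_fderiv {L α k M : ℝ} (hα : α ∈ Ioo (1 / 2 : ℝ) 1)
    (hk : k ∈ Icc (0 : ℝ) 1) {f : ℝ × ℝ → ℝ} (hf : Nice L α k M f) :
    ContinuousOn (fderiv ℝ f) (Om L) := by
  intro p hp
  refine ContinuousAt.continuousWithinAt ?_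
  have hw := wt_pos hk hp
  have hα0 : 0 < α := by linarith [hα.1]
  rw [ContinuousAt, tendsto_iff_norm_sub_tendsto_zero]
  have hlim : Filter.Tendsto (fun q : ℝ × ℝ => M / (wt k p / 2) * ‖q - p‖ ^ α) (nhds p)
      (nhds 0) := by
    have hc : Continuous (fun q : ℝ × ℝ => M / (wt k p / 2) * ‖q - p‖ ^ α) := by
      refine continuous_const.mul (Continuous.rpow_const (by fun_prop) (fun _ => Or.inr hα0.le))
    have := hc.tendsto p
    simpa [Real.zero_rpow hα0.ne'] using this
  refine squeeze_zero' (Filter.Eventually.of_forall (fun _ => norm_nonneg _)) ?_ hlim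
  have h1 : ∀ᶠ q in nhds p, wt k p / 2 < wt k q :=
    (continuous_wt k).continuousAt.eventually (lt_mem_nhds (half_lt_self hw))
  filter_upwards [h1, (isOpen_Om L).mem_nhds hp] with q hq hqO
  have := hf.b2 q hqO p hp (wt k p / 2) (half_pos hw) hq.le (half_le_self hw.le)
  rw [div_mul_eq_mul_div, le_div_iff₀ (half_pos hw), mul_comm]
  exact this

lemma continuousOn_Sm_left {L : ℝ} {p : ℝ × ℝ} (hp : p ∈ Om L) {X : Type*} [TopologicalSpace X]
    {g : ℝ × ℝ → X} (hg : ContinuousOn g (Om L)) :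
    ContinuousOn (fun t => g (Sm t p)) (Ioc (0 : ℝ) 1) := by
  refine hg.comp (Continuous.continuousOn ?_) (fun t ht => Sm_mem ht hp)
  simp only [Sm_apply]; fun_prop

lemma integral_two_mul_const (c : ℝ) : ∫ t in (0 : ℝ)..1, 2 * t * c = c := by
  have h : ∫ x in (0 : ℝ)..1, 2 * x = 1 := by
    rw [intervalIntegral.integral_const_mul, integral_id]; norm_num
  rw [intervalIntegral.integral_mul_const, h, one_mul]

lemma intervalIntegrable_of_bdd {X : Type*} [NormedAddCommGroup X] {g : ℝ → X} {C : ℝ}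
    (hg : ContinuousOn g (Ioc (0 : ℝ) 1)) (hb : ∀ t ∈ Ioc (0 : ℝ) 1, ‖g t‖ ≤ C) :
    IntervalIntegrable g volume 0 1 := by
  rw [intervalIntegrable_iff, uIoc_of_le zero_le_one]
  refine ⟨hg.aestronglyMeasurable measurableSet_Ioc, ?_⟩
  refine HasFiniteIntegral.restrict_of_bounded C (by simp) ?_
  exact (ae_restrict_iff' measurableSet_Ioc).2 (Filter.Eventually.of_forall hb)

lemma Nice.meanF_int {L α k M : ℝ} {f : ℝ × ℝ → ℝ} (hf : Nice L α k M f) {p : ℝ × ℝ}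
    (hp : p ∈ Om L) : IntervalIntegrable (fun t => 2 * t * f (Sm t p)) volume 0 1 := by
  refine intervalIntegrable_of_bdd (C := 2 * M)
    (ContinuousOn.mul (by fun_prop) (continuousOn_Sm_left hp hf.continuousOn)) ?_
  intro t ht
  have h1 := hf.b0 _ (Sm_mem ht hp)
  have h2 : |2 * t| ≤ 2 := by rw [abs_of_nonneg (by linarith [ht.1])]; linarith [ht.2]
  rw [Real.norm_eq_abs, abs_mul]
  gcongr

lemma Nice.mean_mem {L α k M a b : ℝ} {f : ℝ × ℝ → ℝ} (hf : Nice L α k M f)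
    (hr : ∀ p ∈ Om L, f p ∈ Icc a b) : ∀ p ∈ Om L, mean f p ∈ Icc a b := by
  intro p hp
  have hi := hf.meanF_int hp
  have hc : ∀ c : ℝ, IntervalIntegrable (fun t : ℝ => 2 * t * c) volume 0 1 :=
    fun c => Continuous.intervalIntegrable (by fun_prop) _ _
  have key : ∀ t ∈ Icc (0 : ℝ) 1, 2 * t * a ≤ 2 * t * f (Sm t p) ∧
      2 * t * f (Sm t p) ≤ 2 * t * b := by
    intro t ht
    rcases ht.1.eq_or_lt with h | h
    · subst h; simp
    · have := hr _ (Sm_mem ⟨h, ht.2⟩ hp)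
      exact ⟨mul_le_mul_of_nonneg_left this.1 (by linarith),
        mul_le_mul_of_nonneg_left this.2 (by linarith)⟩
  constructor
  · rw [← integral_two_mul_const a]
    exact intervalIntegral.integral_mono_on zero_le_one (hc a) hi (fun t ht => (key t ht).1)
  · rw [← integral_two_mul_const b]
    exact intervalIntegral.integral_mono_on zero_le_one hi (hc b) (fun t ht => (key t ht).2)

/-- The gradient of the integrand in the average. -/
def meanD (f : ℝ × ℝ → ℝ) (p : ℝ × ℝ) (t : ℝ) : ℝ × ℝ →L[ℝ] ℝ :=
  (2 * t) • (fderiv ℝ f (Sm t p)).comp (Sm t)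

lemma meanD_norm {L α k M : ℝ} (hk : k ∈ Icc (0 : ℝ) 1)
    {f : ℝ × ℝ → ℝ} (hf : Nice L α k M f) {p : ℝ × ℝ}
    (hp : p ∈ Om L) {d : ℝ} (hd : 0 < d) (hdp : d ≤ wt k p) {t : ℝ} (ht : t ∈ Ioc (0 : ℝ) 1) :
    ‖meanD f p t‖ ≤ 2 * t * (M / d ^ (1 - α)) := by
  have hd' : 0 < d ^ (1 - α) := Real.rpow_pos_of_pos hd _
  have h1 := hf.b1 _ (Sm_mem ht hp) d hd (hdp.trans (wt_Sm hk ht hp))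
  have h2 : ‖fderiv ℝ f (Sm t p)‖ ≤ M / d ^ (1 - α) := by
    rw [le_div_iff₀ hd', mul_comm]; exact h1
  have h3 : ‖(fderiv ℝ f (Sm t p)).comp (Sm t)‖ ≤ M / d ^ (1 - α) := by
    refine (ContinuousLinearMap.opNorm_comp_le _ _).trans ?_
    exact (mul_le_of_le_one_right (norm_nonneg _) (norm_Sm_le ⟨ht.1.le, ht.2⟩)).trans h2
  have h0 : 0 ≤ 2 * t := by linarith [ht.1]
  unfold meanD
  rw [norm_smul, Real.norm_eq_abs, abs_of_nonneg h0]
  gcongr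

lemma meanD_cont {L α k M : ℝ} (hα : α ∈ Ioo (1 / 2 : ℝ) 1) (hk : k ∈ Icc (0 : ℝ) 1)
    {f : ℝ × ℝ → ℝ} (hf : Nice L α k M f) {p : ℝ × ℝ}
    (hp : p ∈ Om L) : ContinuousOn (meanD f p) (Ioc (0 : ℝ) 1) := by
  have h2 : ContinuousOn (fun t : ℝ => 2 * t) (Ioc (0 : ℝ) 1) := by fun_prop
  refine h2.smul ?_
  exact (continuousOn_Sm_left hp (hf.continuousOn_fderiv hα hk)).clm_comp
    continuous_Sm.continuousOn

lemma meanD_int {L α k M : ℝ} (hα : α ∈ Ioo (1 / 2 : ℝ) 1) (hk : k ∈ Icc (0 : ℝ) 1)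
    {f : ℝ × ℝ → ℝ} (hf : Nice L α k M f) {p : ℝ × ℝ}
    (hp : p ∈ Om L) : IntervalIntegrable (meanD f p) volume 0 1 := by
  have hM := hf.nonneg hp
  have hw := wt_pos hk hp
  refine intervalIntegrable_of_bdd (C := 2 * 1 * (M / wt k p ^ (1 - α)))
    (meanD_cont hα hk hf hp) (fun t ht => ?_)
  refine (meanD_norm hk hf hp hw le_rfl ht).trans ?_
  have := ht.2
  gcongr

lemma mean_hasFDerivAt {L α k M : ℝ} (hα : α ∈ Ioo (1 / 2 : ℝ) 1) (hk : k ∈ Icc (0 : ℝ) 1)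
    {f : ℝ × ℝ → ℝ} (hf : Nice L α k M f) {p : ℝ × ℝ}
    (hp : p ∈ Om L) : HasFDerivAt (mean f) (∫ t in (0 : ℝ)..1, meanD f p t) p := by
  have hM := hf.nonneg hp
  have hw := wt_pos hk hp
  have h1 : ∀ᶠ q in nhds p, wt k p / 2 < wt k q :=
    (continuous_wt k).continuousAt.eventually (lt_mem_nhds (half_lt_self hw))
  have hO : ∀ᶠ q in nhds p, q ∈ Om L := (isOpen_Om L).mem_nhds hp
  refine intervalIntegral.hasFDerivAt_integral_of_dominated_of_fderiv_le
    (F := fun q t => 2 * t * f (Sm t q)) (F' := meanD f)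
    (s := {q | wt k p / 2 < wt k q ∧ q ∈ Om L})
    (bound := fun t => 2 * t * (M / (wt k p / 2) ^ (1 - α)))
    (h1.and hO) ?_ (hf.meanF_int hp) ?_ ?_ ?_ ?_
  · filter_upwards [hO] with q hq
    rw [uIoc_of_le zero_le_one]
    exact (ContinuousOn.mul (by fun_prop)
      (continuousOn_Sm_left hq hf.continuousOn)).aestronglyMeasurable measurableSet_Ioc
  · rw [uIoc_of_le zero_le_one]
    exact (meanD_cont hα hk hf hp).aestronglyMeasurable measurableSet_Ioc
  · refine Filter.Eventually.of_forall (fun t ht q hq => ?_)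
    rw [uIoc_of_le zero_le_one] at ht
    exact meanD_norm hk hf hq.2 (half_pos hw) hq.1.le ht
  · exact Continuous.intervalIntegrable (by fun_prop) _ _
  · refine Filter.Eventually.of_forall (fun t ht q hq => ?_)
    rw [uIoc_of_le zero_le_one] at ht
    have hd := (hf.diff _ (Sm_mem ht hq.2)).hasFDerivAt
    exact (hd.comp q (Sm t).hasFDerivAt).const_mul (2 * t)

lemma Nice.mean {L α k M : ℝ} (hα : α ∈ Ioo (1 / 2 : ℝ) 1) (hk : k ∈ Icc (0 : ℝ) 1)
    {f : ℝ × ℝ → ℝ} (hf : Nice L α k M f) : Nice L α k M (mean f) := by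
  have hα0 : 0 < α := by linarith [hα.1]
  refine Nice.of_hasFDerivAt (f' := fun p => ∫ t in (0 : ℝ)..1, meanD f p t)
    (fun p hp => mean_hasFDerivAt hα hk hf hp) ?_ ?_ ?_
  · intro p hp
    rw [abs_le]
    exact hf.mean_mem (fun q hq => abs_le.1 (hf.b0 q hq)) p hp
  · intro p hp d hd hdp
    have hd' : 0 < d ^ (1 - α) := Real.rpow_pos_of_pos hd _
    have h := intervalIntegral.norm_integral_le_of_norm_le (μ := volume) (f := meanD f p)
      (g := fun t => 2 * t * (M / d ^ (1 - α))) (zero_le_one)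
      (Filter.Eventually.of_forall (fun t ht => meanD_norm hk hf hp hd hdp ht))
      (Continuous.intervalIntegrable (by fun_prop) _ _)
    rw [integral_two_mul_const, le_div_iff₀ hd', mul_comm] at h
    exact h
  · intro p hp q hq d hd hdp hdq
    have hM := hf.nonneg hp
    rw [← intervalIntegral.integral_sub (meanD_int hα hk hf hp) (meanD_int hα hk hf hq)]
    have hb : ∀ t ∈ Ioc (0 : ℝ) 1, ‖meanD f p t - meanD f q t‖
        ≤ 2 * t * (M * ‖p - q‖ ^ α / d) := by
      intro t ht
      have hS := norm_Sm_le (t := t) ⟨ht.1.le, ht.2⟩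
      have h1 := hf.b2 _ (Sm_mem ht hp) _ (Sm_mem ht hq) d hd (hdp.trans (wt_Sm hk ht hp))
        (hdq.trans (wt_Sm hk ht hq))
      have h2 : ‖Sm t p - Sm t q‖ ≤ ‖p - q‖ := by
        rw [← map_sub]
        exact ((Sm t).le_opNorm _).trans (mul_le_of_le_one_left (norm_nonneg _) hS)
      have h3 : ‖fderiv ℝ f (Sm t p) - fderiv ℝ f (Sm t q)‖ ≤ M * ‖p - q‖ ^ α / d := by
        rw [le_div_iff₀ hd, mul_comm]
        refine h1.trans ?_
        gcongr
      have e : meanD f p t - meanD f q t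
          = (2 * t) • (fderiv ℝ f (Sm t p) - fderiv ℝ f (Sm t q)).comp (Sm t) := by
        unfold meanD
        ext
        all_goals simp
        all_goals ring
      have h0 : 0 ≤ 2 * t := by linarith [ht.1]
      rw [e, norm_smul, Real.norm_eq_abs, abs_of_nonneg h0]
      gcongr
      refine (ContinuousLinearMap.opNorm_comp_le _ _).trans ?_
      exact (mul_le_of_le_one_right (norm_nonneg _) hS).trans h3
    have h := intervalIntegral.norm_integral_le_of_norm_le (μ := volume)
      (f := fun t => meanD f p t - meanD f q t)
      (g := fun t => 2 * t * (M * ‖p - q‖ ^ α / d)) (zero_le_one)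
      (Filter.Eventually.of_forall hb)
      (Continuous.intervalIntegrable (by fun_prop) _ _)
    rw [integral_two_mul_const, le_div_iff₀ hd, mul_comm] at h
    exact h

/-! ### Conversions between the norms of the statement and the auxiliary classes -/

lemma iterated_one_sub {E : Type*} [NormedAddCommGroup E] [NormedSpace ℝ E]
    (u : E → ℝ) (x y : E) :
    ‖iteratedFDeriv ℝ 1 u x - iteratedFDeriv ℝ 1 u y‖ = ‖fderiv ℝ u x - fderiv ℝ u y‖ := by
  have h : ∀ z, iteratedFDeriv ℝ 1 u z
      = (continuousMultilinearCurryFin1 ℝ E ℝ).symm (fderiv ℝ u z) := by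
    intro z; ext m; simp
  rw [h x, h y, ← map_sub, LinearIsometryEquiv.norm_map]

lemma infDist_Sig {L : ℝ} {p : ℝ × ℝ} (hp : p ∈ Om L) :
    Metric.infDist p (Sig L) = wt 1 p := by
  have hmem : (p.1, (1 / 2 : ℝ)) ∈ Sig L := ⟨hp.1, rfl⟩
  have h2 := hp.2.2
  refine le_antisymm ?_ ?_
  · refine (Metric.infDist_le_dist_of_mem hmem).trans ?_
    rw [Prod.dist_eq]
    refine max_le ?_ ?_
    · simp only [dist_self]; exact (wt_pos ⟨zero_le_one, le_rfl⟩ hp).le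
    · simp only [Real.dist_eq]
      rw [abs_sub_comm, abs_of_pos (by linarith)]
      unfold wt; linarith
  · refine (Metric.le_infDist ⟨_, hmem⟩).2 ?_
    intro y hy
    have hy2 : y.2 = 1 / 2 := hy.2
    rw [Prod.dist_eq]
    refine le_trans ?_ (le_max_right _ _)
    rw [Real.dist_eq, hy2, abs_sub_comm, abs_of_pos (by linarith)]
    unfold wt; linarith

lemma wSupSet_nonneg {E F : Type*} [NormedAddCommGroup E] [NormedSpace ℝ E]
    [NormedAddCommGroup F] [NormedSpace ℝ F] (i : ℕ) (k : ℝ) (D P : Set E) (u : E → F) :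
    0 ≤ sSup (wSupSet i k D P u) := by
  refine Real.sSup_nonneg ?_
  rintro t ⟨x, _, rfl⟩
  exact mul_nonneg (Real.rpow_nonneg Metric.infDist_nonneg _) (norm_nonneg _)

lemma wSemiSet_nonneg {E F : Type*} [NormedAddCommGroup E] [NormedSpace ℝ E]
    [NormedAddCommGroup F] [NormedSpace ℝ F] (m : ℕ) (α k : ℝ) (D P : Set E) (u : E → F) :
    0 ≤ sSup (wSemiSet m α k D P u) := by
  refine Real.sSup_nonneg ?_
  rintro t ⟨x, _, y, _, _, rfl⟩
  refine mul_nonneg (Real.rpow_nonneg (le_min Metric.infDist_nonneg Metric.infDist_nonneg) _) ?_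
  positivity

lemma wNorm_one {E F : Type*} [NormedAddCommGroup E] [NormedSpace ℝ E]
    [NormedAddCommGroup F] [NormedSpace ℝ F] (α k : ℝ) (D P : Set E) (u : E → F) :
    wNorm 1 α k D P u = sSup (wSupSet 0 k D P u) + sSup (wSupSet 1 k D P u)
      + sSup (wSemiSet 1 α k D P u) := by
  simp [wNorm, Finset.sum_range_succ]

lemma wNorm_one_nonneg {E F : Type*} [NormedAddCommGroup E] [NormedSpace ℝ E]
    [NormedAddCommGroup F] [NormedSpace ℝ F] (α k : ℝ) (D P : Set E) (u : E → F) :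
    0 ≤ wNorm 1 α k D P u := by
  rw [wNorm_one]
  exact add_nonneg (add_nonneg (wSupSet_nonneg _ _ _ _ _) (wSupSet_nonneg _ _ _ _ _))
    (wSemiSet_nonneg _ _ _ _ _ _)

lemma exps {α : ℝ} (hα : α ∈ Ioo (1 / 2 : ℝ) 1) :
    max (((0 : ℕ) : ℝ) + -α) 0 = 0 ∧ max (((1 : ℕ) : ℝ) + -α) 0 = 1 - α ∧
      max (((1 : ℕ) : ℝ) + α + -α) 0 = 1 := by
  have h1 := hα.1
  have h2 := hα.2
  refine ⟨?_, ?_, ?_⟩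
  · rw [max_eq_right]; push_cast; linarith
  · rw [max_eq_left] <;> push_cast <;> linarith
  · rw [max_eq_left] <;> push_cast <;> linarith

lemma MemW.nice {L α M : ℝ} (hα : α ∈ Ioo (1 / 2 : ℝ) 1) {u : ℝ × ℝ → ℝ}
    (hu : MemW 1 α (-α) (Om L) (Sig L) u) (hM : wNorm 1 α (-α) (Om L) (Sig L) u ≤ M) :
    Nice L α 1 M u := by
  obtain ⟨hc, hs, hh⟩ := hu
  obtain ⟨e0, e1, e2⟩ := exps hα
  have hk : (1 : ℝ) ∈ Icc (0 : ℝ) 1 := ⟨zero_le_one, le_rfl⟩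
  rw [wNorm_one] at hM
  have n0 := wSupSet_nonneg 0 (-α) (Om L) (Sig L) u
  have n1 := wSupSet_nonneg 1 (-α) (Om L) (Sig L) u
  have n2 := wSemiSet_nonneg 1 α (-α) (Om L) (Sig L) u
  refine ⟨?_, ?_, ?_, ?_⟩
  · intro p hp
    exact (hc.contDiffAt ((isOpen_Om L).mem_nhds hp)).differentiableAt (by simp)
  · intro p hp
    have := le_csSup (hs 0 (by simp)) ⟨p, hp, rfl⟩
    rw [e0, Real.rpow_zero, one_mul, norm_iteratedFDeriv_zero, Real.norm_eq_abs] at this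
    linarith
  · intro p hp d hd hdp
    have := le_csSup (hs 1 le_rfl) ⟨p, hp, rfl⟩
    rw [e1, norm_iteratedFDeriv_one, infDist_Sig hp] at this
    have h1 : 0 ≤ 1 - α := by linarith [hα.2]
    have h2 : d ^ (1 - α) * ‖fderiv ℝ u p‖ ≤ wt 1 p ^ (1 - α) * ‖fderiv ℝ u p‖ := by gcongr
    linarith
  · intro p hp q hq d hd hdp hdq
    rcases eq_or_ne p q with rfl | hne
    · simp only [sub_self, norm_zero, mul_zero]
      have : 0 ≤ M := by linarith
      positivity
    · have := le_csSup hh ⟨p, hp, q, hq, hne, rfl⟩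
      rw [e2, iterated_one_sub, infDist_Sig hp, infDist_Sig hq, Real.rpow_one] at this
      have hpos : 0 < ‖p - q‖ ^ α := Real.rpow_pos_of_pos (norm_pos_iff.2 (sub_ne_zero.2 hne)) _
      have h2 : d * (‖fderiv ℝ u p - fderiv ℝ u q‖ / ‖p - q‖ ^ α)
          ≤ min (wt 1 p) (wt 1 q) * (‖fderiv ℝ u p - fderiv ℝ u q‖ / ‖p - q‖ ^ α) := by
        have := le_min hdp hdq
        gcongr
      have h3 : d * (‖fderiv ℝ u p - fderiv ℝ u q‖ / ‖p - q‖ ^ α) ≤ M := by linarith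
      rw [← mul_div_assoc, div_le_iff₀ hpos] at h3
      exact h3

lemma Nice.memW {L α M : ℝ} (hα : α ∈ Ioo (1 / 2 : ℝ) 1) (hL : 0 < L) {u : ℝ × ℝ → ℝ}
    (hu : Nice L α 1 M u) : MemW 1 α (-α) (Om L) (Sig L) u ∧
      wNorm 1 α (-α) (Om L) (Sig L) u ≤ 3 * M := by
  obtain ⟨e0, e1, e2⟩ := exps hα
  have hk : (1 : ℝ) ∈ Icc (0 : ℝ) 1 := ⟨zero_le_one, le_rfl⟩
  have hM : 0 ≤ M := by
    refine hu.nonneg (p := (L / 2, 1 / 4)) ⟨⟨?_, ?_⟩, ?_, ?_⟩ <;> norm_num <;> linarith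
  have s0 : ∀ t ∈ wSupSet 0 (-α) (Om L) (Sig L) u, t ≤ M := by
    rintro t ⟨p, hp, rfl⟩
    rw [e0, Real.rpow_zero, one_mul, norm_iteratedFDeriv_zero, Real.norm_eq_abs]
    exact hu.b0 p hp
  have s1 : ∀ t ∈ wSupSet 1 (-α) (Om L) (Sig L) u, t ≤ M := by
    rintro t ⟨p, hp, rfl⟩
    rw [e1, norm_iteratedFDeriv_one, infDist_Sig hp]
    exact hu.b1 p hp _ (wt_pos hk hp) le_rfl
  have s2 : ∀ t ∈ wSemiSet 1 α (-α) (Om L) (Sig L) u, t ≤ M := by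
    rintro t ⟨p, hp, q, hq, hne, rfl⟩
    have hpos : 0 < ‖p - q‖ ^ α := Real.rpow_pos_of_pos (norm_pos_iff.2 (sub_ne_zero.2 hne)) _
    rw [e2, iterated_one_sub, infDist_Sig hp, infDist_Sig hq, Real.rpow_one, ← mul_div_assoc,
      div_le_iff₀ hpos]
    exact hu.b2 p hp q hq _ (lt_min (wt_pos hk hp) (wt_pos hk hq)) (min_le_left _ _)
      (min_le_right _ _)
  refine ⟨⟨?_, ?_, ⟨M, s2⟩⟩, ?_⟩
  · intro p hp
    refine ContDiffAt.contDiffWithinAt ?_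
    have := (contDiffOn_succ_iff_fderiv_of_isOpen (𝕜 := ℝ) (n := 0) (f := u) (isOpen_Om L)).2
      ⟨fun p hp => (hu.diff p hp).differentiableWithinAt, by simp,
        contDiffOn_zero.2 (hu.continuousOn_fderiv hα hk)⟩
    rw [zero_add] at this
    exact_mod_cast this.contDiffAt ((isOpen_Om L).mem_nhds hp)
  · intro i hi
    interval_cases i
    · exact ⟨M, s0⟩
    · exact ⟨M, s1⟩
  · rw [wNorm_one]
    have := Real.sSup_le s0 hM
    have := Real.sSup_le s1 hM
    have := Real.sSup_le s2 hM
    linarith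

lemma hNorm_one (α : ℝ) (D : Set ℝ) (u : ℝ → ℝ) :
    hNorm 1 α D u = sSup (hSupSet 0 D u) + sSup (hSupSet 1 D u)
      + sSup (hSemiSet 1 α D u) := by
  simp [hNorm, Finset.sum_range_succ]

lemma hSupSet_nonneg (i : ℕ) (D : Set ℝ) (u : ℝ → ℝ) : 0 ≤ sSup (hSupSet i D u) := by
  refine Real.sSup_nonneg ?_
  rintro t ⟨x, _, rfl⟩
  exact norm_nonneg _

lemma hSemiSet_nonneg (m : ℕ) (α : ℝ) (D : Set ℝ) (u : ℝ → ℝ) :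
    0 ≤ sSup (hSemiSet m α D u) := by
  refine Real.sSup_nonneg ?_
  rintro t ⟨x, _, y, _, _, rfl⟩
  positivity

lemma hNorm_one_nonneg (α : ℝ) (D : Set ℝ) (u : ℝ → ℝ) : 0 ≤ hNorm 1 α D u := by
  rw [hNorm_one]
  exact add_nonneg (add_nonneg (hSupSet_nonneg _ _ _) (hSupSet_nonneg _ _ _))
    (hSemiSet_nonneg _ _ _ _)

lemma MemH.h1 {α M : ℝ} {u : ℝ → ℝ} (hu : MemH 1 α (Icc (0 : ℝ) (1 / 2)) u)
    (hM : hNorm 1 α (Icc (0 : ℝ) (1 / 2)) u ≤ M) : H1 α M u := by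
  obtain ⟨hc, hs, hh⟩ := hu
  rw [hNorm_one] at hM
  have n0 := hSupSet_nonneg 0 (Icc (0 : ℝ) (1 / 2)) u
  have n1 := hSupSet_nonneg 1 (Icc (0 : ℝ) (1 / 2)) u
  have n2 := hSemiSet_nonneg 1 α (Icc (0 : ℝ) (1 / 2)) u
  have hI : ∀ x ∈ Ioo (0 : ℝ) (1 / 2), x ∈ Icc (0 : ℝ) (1 / 2) := fun x hx => ⟨hx.1.le, hx.2.le⟩
  refine ⟨?_, ?_, ?_, ?_⟩
  · intro x hx
    exact (hc.contDiffAt (Icc_mem_nhds hx.1 hx.2)).differentiableAt (by simp)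
  · intro x hx
    have := le_csSup (hs 0 (by simp)) ⟨x, hI x hx, rfl⟩
    rw [norm_iteratedFDeriv_zero, Real.norm_eq_abs] at this
    linarith
  · intro x hx
    have := le_csSup (hs 1 le_rfl) ⟨x, hI x hx, rfl⟩
    rw [norm_iteratedFDeriv_one, ← norm_deriv_eq_norm_fderiv, Real.norm_eq_abs] at this
    linarith
  · intro x hx y hy
    rcases eq_or_ne x y with rfl | hne
    · simp only [sub_self, abs_zero]
      have : 0 ≤ M := by linarith
      positivity
    · have := le_csSup hh ⟨x, hI x hx, y, hI y hy, hne, rfl⟩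
      rw [iterated_one_sub] at this
      have hpos : 0 < ‖x - y‖ ^ α := Real.rpow_pos_of_pos (norm_pos_iff.2 (sub_ne_zero.2 hne)) _
      have h3 : ‖fderiv ℝ u x - fderiv ℝ u y‖ / ‖x - y‖ ^ α ≤ M := by linarith
      rw [div_le_iff₀ hpos] at h3
      have h4 := (fderiv ℝ u x - fderiv ℝ u y).le_opNorm 1
      rw [norm_one, mul_one] at h4
      simp only [ContinuousLinearMap.sub_apply, fderiv_apply_one_eq_deriv,
        Real.norm_eq_abs] at h4 h3
      exact h4.trans h3

lemma MemH.sub_const {α : ℝ} {u : ℝ → ℝ} {D : Set ℝ} (hu : MemH 1 α D u) (c : ℝ) :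
    MemH 1 α D (fun r => u r - c) := by
  obtain ⟨hc, hs, hh⟩ := hu
  have e : ∀ x, iteratedFDeriv ℝ 1 (fun r => u r - c) x = iteratedFDeriv ℝ 1 u x := by
    intro x; ext m; simp
  refine ⟨hc.sub contDiffOn_const, ?_, ?_⟩
  · intro i hi
    interval_cases i
    · obtain ⟨b, hb⟩ := hs 0 (by simp)
      refine ⟨b + |c|, ?_⟩
      rintro t ⟨x, hx, rfl⟩
      have := hb ⟨x, hx, rfl⟩
      rw [norm_iteratedFDeriv_zero, Real.norm_eq_abs] at this ⊢
      linarith [abs_sub (u x) c]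
    · have h1 := hs 1 le_rfl
      have : hSupSet 1 D (fun r => u r - c) = hSupSet 1 D u := by
        simp only [hSupSet, e]
      rw [this]; exact h1
  · have : hSemiSet 1 α D (fun r => u r - c) = hSemiSet 1 α D u := by
      simp only [hSemiSet, e]
    rw [this]; exact hh

lemma H1.add_const {α K c : ℝ} {u : ℝ → ℝ} (h : H1 α K (fun r => u r - c)) :
    H1 α (K + |c|) u := by
  have hd : ∀ x, deriv (fun r => u r - c) x = deriv u x := fun x => deriv_sub_const c
  have hc := abs_nonneg c
  refine ⟨?_, ?_, ?_, ?_⟩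
  · intro x hx
    simpa using (h.diff x hx).add_const c
  · intro x hx
    have h1 := h.b0 x hx
    have h2 := abs_add_le (u x - c) c
    simp only [sub_add_cancel] at h2
    linarith
  · intro x hx
    have h1 := h.b1 x hx
    rw [hd] at h1; linarith
  · intro x hx y hy
    have h1 := h.b2 x hx y hy
    rw [hd, hd] at h1
    refine h1.trans ?_
    gcongr; linarith

lemma mean_inv {α k : ℝ} (hα : α ∈ Ioo (1 / 2 : ℝ) 1) (hk : k ∈ Icc (0 : ℝ) 1)
    (M a b e : ℝ) (ha : 0 < a) (hb : 0 < b) : ∃ M' : ℝ, ∀ (L : ℝ) (f : ℝ × ℝ → ℝ),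
      Nice L α k M f → (∀ p ∈ Om L, f p ∈ Icc a b) →
      Nice L α k M' (fun p => mean (fun q => (f q)⁻¹) p ^ e) ∧
      ∀ p ∈ Om L, mean (fun q => (f q)⁻¹) p ∈ Icc b⁻¹ a⁻¹ := by
  obtain ⟨M1, h1⟩ := Nice.rpow hα hk M a b (-1) ha
  obtain ⟨M2, h2⟩ := Nice.rpow hα hk M1 b⁻¹ a⁻¹ e (inv_pos.2 hb)
  refine ⟨M2, fun L f hf hr => ?_⟩
  have hi : Nice L α k M1 (fun q => (f q)⁻¹) :=
    (h1 L f hf hr).congr (fun p _ => (Real.rpow_neg_one _).symm)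
  have hir : ∀ p ∈ Om L, (f p)⁻¹ ∈ Icc b⁻¹ a⁻¹ := fun p hp =>
    ⟨inv_anti₀ (ha.trans_le (hr p hp).1) (hr p hp).2, inv_anti₀ ha (hr p hp).1⟩
  have hm := hi.mean_mem hir
  exact ⟨h2 L _ (hi.mean hα hk) hm, hm⟩

lemma rho_piece {α : ℝ} (hα : α ∈ Ioo (1 / 2 : ℝ) 1) {γ ub : ℝ} (hγ : 1 < γ)
    (KA KB a1 a2 x1 x2 u1 u2 : ℝ) (ha1 : 0 < a1) (ha2 : 0 < a2) (hx1 : 0 < x1) (hx2 : 0 < x2)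
    (hu1 : 0 < u1) (hu2 : 0 < u2) :
    ∃ M lo hi : ℝ, 0 < lo ∧ 0 < hi ∧ ∀ (L : ℝ) (A B W1 W2 W3 : ℝ × ℝ → ℝ),
      Nice L α 1 KA A → Nice L α 1 KB B → Nice L α 1 1 W1 → Nice L α 1 1 W2 → Nice L α 1 1 W3 →
      (∀ p ∈ Om L, A p ∈ Icc a1 a2) →
      (∀ p ∈ Om L, B p - ((W1 p + ub) ^ 2 + W2 p ^ 2 + W3 p ^ 2) / 2 ∈ Icc x1 x2) →
      (∀ p ∈ Om L, W1 p + ub ∈ Icc u1 u2) →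
      Nice L α 1 M (fun p => Hd γ (B p) (A p) ((W1 p + ub) ^ 2 + W2 p ^ 2 + W3 p ^ 2) *
        (W1 p + ub)) ∧
      ∀ p ∈ Om L, Hd γ (B p) (A p) ((W1 p + ub) ^ 2 + W2 p ^ 2 + W3 p ^ 2) *
        (W1 p + ub) ∈ Icc lo hi := by
  have hk : (1 : ℝ) ∈ Icc (0 : ℝ) 1 := ⟨zero_le_one, le_rfl⟩
  have hg1 : 0 < γ - 1 := by linarith
  have hg0 : 0 < γ := by linarith
  have hcc : 0 < (γ - 1) / γ := by positivity
  have he : 0 ≤ 1 / (γ - 1) := by positivity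
  obtain ⟨MA, hMA⟩ := Nice.rpow hα hk KA a1 a2 (-1) ha1
  set Mq : ℝ := 8 * (1 + |ub|) * (1 + |ub|) + 8 * 1 * 1 + 8 * 1 * 1 with hMq
  set Mbase : ℝ := 8 * |(γ - 1) / γ| * (8 * (KB + 8 * |(-(1 / 2) : ℝ)| * Mq) * MA) with hMb
  set bl : ℝ := (γ - 1) / γ * (x1 * a2⁻¹) with hbl
  set bh : ℝ := (γ - 1) / γ * (x2 * a1⁻¹) with hbh
  have hbl0 : 0 < bl := by positivity
  have hbh0 : 0 < bh := by positivity
  obtain ⟨Mr, hMr⟩ := Nice.rpow hα hk Mbase bl bh (1 / (γ - 1)) hbl0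
  refine ⟨8 * Mr * (1 + |ub|), bl ^ (1 / (γ - 1)) * u1, bh ^ (1 / (γ - 1)) * u2,
    by positivity, by positivity, ?_⟩
  intro L A B W1 W2 W3 hA hB h1 h2 h3 rA rB rU
  have hu : Nice L α 1 (1 + |ub|) (fun p => W1 p + ub) := h1.add (Nice.const ub)
  have hq := ((hu.mul hα hk hu).add (h2.mul hα hk h2)).add (h3.mul hα hk h3)
  have hx := hB.add ((Nice.const (-(1 / 2) : ℝ)).mul hα hk hq)
  have hb := (Nice.const ((γ - 1) / γ)).mul hα hk (hx.mul hα hk (hMA L A hA rA))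
  have eqb : ∀ p ∈ Om L, (γ - 1) * (B p - ((W1 p + ub) ^ 2 + W2 p ^ 2 + W3 p ^ 2) / 2) / (A p * γ)
      = (γ - 1) / γ * ((B p - ((W1 p + ub) ^ 2 + W2 p ^ 2 + W3 p ^ 2) / 2) * (A p)⁻¹) := by
    intro p hp
    have : A p ≠ 0 := (ha1.trans_le (rA p hp).1).ne'
    field_simp
  have hb' : Nice L α 1 Mbase (fun p => (γ - 1) *
      (B p - ((W1 p + ub) ^ 2 + W2 p ^ 2 + W3 p ^ 2) / 2) / (A p * γ)) := by
    refine hb.congr (fun p hp => ?_)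
    rw [eqb p hp, Real.rpow_neg_one]
    ring
  have rb : ∀ p ∈ Om L, (γ - 1) *
      (B p - ((W1 p + ub) ^ 2 + W2 p ^ 2 + W3 p ^ 2) / 2) / (A p * γ) ∈ Icc bl bh := by
    intro p hp
    rw [eqb p hp]
    have hA0 : 0 < A p := ha1.trans_le (rA p hp).1
    have i1 : a2⁻¹ ≤ (A p)⁻¹ := inv_anti₀ hA0 (rA p hp).2
    have i2 : (A p)⁻¹ ≤ a1⁻¹ := inv_anti₀ ha1 (rA p hp).1
    have j := rB p hp
    have j0 := hx1.trans_le j.1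
    refine ⟨mul_le_mul_of_nonneg_left ?_ hcc.le, mul_le_mul_of_nonneg_left ?_ hcc.le⟩
    · exact mul_le_mul j.1 i1 (by positivity) j0.le
    · exact mul_le_mul j.2 i2 (by positivity) hx2.le
  have hr := hMr L _ hb' rb
  refine ⟨hr.mul hα hk hu, fun p hp => ?_⟩
  unfold Hd
  have hr0 := rb p hp
  have hp0 := hbl0.trans_le hr0.1
  have k1 := Real.rpow_le_rpow hbl0.le hr0.1 he
  have k2 := Real.rpow_le_rpow hp0.le hr0.2 he
  exact ⟨mul_le_mul k1 (rU p hp).1 hu1.le (by positivity),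
    mul_le_mul k2 (rU p hp).2 (hu1.le.trans (rU p hp).1) (by positivity)⟩

/-- the square root map `θ(y) = (∫₀^y 2s/J₀)^{1/2}` -/
lemma theta_piece {α : ℝ} (hα : α ∈ Ioo (1 / 2 : ℝ) 1) :
    ∃ M : ℝ, 1 ≤ M ∧ ∀ (L : ℝ) (J0 : ℝ → ℝ), H1 α 3 J0 →
      (∀ x ∈ Ioo (0 : ℝ) (1 / 2), J0 x ∈ Icc (1 : ℝ) 3) →
      Nice L α 0 M (fun p => Real.sqrt (∫ s in (0:ℝ)..p.2, 2 * s / J0 s)) ∧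
      ∀ p ∈ Om L, Real.sqrt (∫ s in (0:ℝ)..p.2, 2 * s / J0 s) ∈ Ioo (0 : ℝ) (1 / 2) := by
  have hk : (0 : ℝ) ∈ Icc (0 : ℝ) 1 := ⟨le_rfl, zero_le_one⟩
  obtain ⟨M, hM⟩ := mean_inv hα hk (3 * (1 + 4 * 1 * 1)) 1 3 (1 / 2) one_pos (by norm_num)
  refine ⟨max 1 (8 * 1 * M), le_max_left _ _, fun L J0 hJ hr => ?_⟩
  have hn : Nice L α 0 (3 * (1 + 4 * 1 * 1)) (fun p => J0 p.2) :=
    Nice.comp_H1 hα le_rfl (Nice.snd hα) (fun p hp => hp.2) hJ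
  obtain ⟨h1, h2⟩ := hM L _ hn (fun p hp => hr p.2 hp.2)
  have key : ∀ p ∈ Om L, Real.sqrt (∫ s in (0:ℝ)..p.2, 2 * s / J0 s)
      = p.2 * mean (fun q => (J0 q.2)⁻¹) p ^ (1 / 2 : ℝ) := by
    intro p hp
    have := integral_eq_mean (fun q => (J0 q.2)⁻¹) p
    simp only [← div_eq_mul_inv] at this
    rw [this, Real.sqrt_mul (sq_nonneg _), Real.sqrt_sq hp.2.1.le, Real.sqrt_eq_rpow]
  refine ⟨(((Nice.snd hα).mul hα hk h1).congr key).mono (le_max_right _ _), fun p hp => ?_⟩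
  rw [key p hp]
  have hm := h2 p hp
  have hm0 : 0 < mean (fun q => (J0 q.2)⁻¹) p := lt_of_lt_of_le (by norm_num) hm.1
  have hm1 : mean (fun q => (J0 q.2)⁻¹) p ^ (1 / 2 : ℝ) ≤ 1 :=
    Real.rpow_le_one hm0.le (hm.2.trans_eq inv_one) (by norm_num)
  have hy := hp.2.1
  exact ⟨mul_pos hy (Real.rpow_pos_of_pos hm0 _),
    (mul_le_of_le_one_right hy.le hm1).trans_lt hp.2.2⟩

lemma swirl_eq {L γ ub : ℝ} {tJ tν tA tB : ℝ → ℝ} {W1 W2 W3 : ℝ × ℝ → ℝ} {p : ℝ × ℝ}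
    (hp : p ∈ Om L)
    (hJ : 0 < mean (fun q => (tJ q.2)⁻¹) p)
    (hg : 0 < mean (fun q => (Hd γ (tB q.2) (tA q.2) ((W1 q + ub) ^ 2 + W2 q ^ 2 + W3 q ^ 2) *
        (W1 q + ub))⁻¹) p) :
    swirlW γ ub tJ tν tA tB W1 W2 W3 p =
      mean (fun q => (tJ q.2)⁻¹) p ^ (1 / 2 : ℝ) *
      mean (fun q => (Hd γ (tB q.2) (tA q.2) ((W1 q + ub) ^ 2 + W2 q ^ 2 + W3 q ^ 2) *
        (W1 q + ub))⁻¹) p ^ (-(1 / 2) : ℝ) * tν p.2 := by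
  have e1 := integral_eq_mean (fun q => (tJ q.2)⁻¹) p
  have e2 := integral_eq_mean (fun q => (Hd γ (tB q.2) (tA q.2)
    ((W1 q + ub) ^ 2 + W2 q ^ 2 + W3 q ^ 2) * (W1 q + ub))⁻¹) p
  unfold swirlW LamHat rW rhoW
  set m1 := mean (fun q => (tJ q.2)⁻¹) p
  set m2 := mean (fun q => (Hd γ (tB q.2) (tA q.2) ((W1 q + ub) ^ 2 + W2 q ^ 2 + W3 q ^ 2) *
        (W1 q + ub))⁻¹) p
  simp only [← div_eq_mul_inv] at e1 e2
  rw [e1, e2, ← mul_assoc, ← mul_assoc, 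
    Real.sqrt_mul (by positivity : (0:ℝ) ≤ 2 * p.2 ^ 2) m1,
    Real.sqrt_mul (by positivity : (0:ℝ) ≤ 2 * p.2 ^ 2) m2,
    Real.rpow_neg hg.le, ← Real.sqrt_eq_rpow, ← Real.sqrt_eq_rpow]
  have hy : 0 < p.2 := hp.2.1
  have : 0 < Real.sqrt (2 * p.2 ^ 2) := Real.sqrt_pos.2 (by positivity)
  have : 0 < Real.sqrt m2 := Real.sqrt_pos.2 hg
  field_simp


/-- for `Ŵ ∈ J(δ₁)`, the swirl velocity
`W₃(y₁,y₂) = Λ̂(y₂)/r̂(y₁,y₂)` determined by the angular momentum conservation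
`∂_{y₁}(r u_θ) = 0` satisfies `‖W₃‖_{1,α;Ω}^{(-α,Σ)} ≤ C σ_cd`, with `C > 0`
depending only on the background state `(U_b⁻, L, α)`. -/
theorem statement_7 (γ ρb ub Pb L α : ℝ) (hbg : Background γ ρb ub Pb L α) :
    ∃ C > 0, ∃ ε > 0,
      ∀ (δ1 : ℝ) (J0 ν0 A0 B0 : ℝ → ℝ) (hW1 hW2 hW3 : ℝ × ℝ → ℝ),
        MemData α J0 ν0 A0 B0 →
        δ1 ≤ ε →
        sigmaCD α γ ρb ub Pb J0 ν0 A0 B0 ≤ ε →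
        InJball L α δ1 hW1 hW2 hW3 →
        MemW 1 α (-α) (Om L) (Sig L)
          (swirlW γ ub (tData J0 J0) (tData J0 ν0) (tData J0 A0) (tData J0 B0) hW1 hW2 hW3) ∧
        wNorm 1 α (-α) (Om L) (Sig L)
          (swirlW γ ub (tData J0 J0) (tData J0 ν0) (tData J0 A0) (tData J0 B0) hW1 hW2 hW3) ≤
          C * sigmaCD α γ ρb ub Pb J0 ν0 A0 B0 := by
  have hα := hbg.hα
  have hk1 : (1 : ℝ) ∈ Icc (0 : ℝ) 1 := ⟨zero_le_one, le_rfl⟩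
  have hk0 : (0 : ℝ) ∈ Icc (0 : ℝ) 1 := ⟨le_rfl, zero_le_one⟩
  have hγ := hbg.hγ
  have hub := hbg.hub
  have hJb : Jb ρb ub = 2 := hbg.normalized
  have hAb : 0 < Ab γ ρb Pb := div_pos hbg.hPb (Real.rpow_pos_of_pos hbg.hρb _)
  obtain ⟨c0, hc0⟩ : ∃ c0, c0 = γ * Pb / ((γ - 1) * ρb) := ⟨_, rfl⟩
  have hc0p : 0 < c0 := by
    rw [hc0]
    exact div_pos (mul_pos (by linarith) hbg.hPb) (mul_pos (by linarith) hbg.hρb)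
  have hBb : Bb γ ρb ub Pb = ub ^ 2 / 2 + c0 := by rw [hc0]; rfl
  have hBb0 : 0 < Bb γ ρb ub Pb := by rw [hBb]; positivity
  set a := Ab γ ρb Pb with ha
  set b := Bb γ ρb ub Pb with hb
  obtain ⟨Mθ, hMθ1, hθ⟩ := theta_piece hα
  obtain ⟨MJ, hMJ⟩ := mean_inv hα hk0 (3 * (1 + 4 * Mθ * Mθ)) 1 3 (1 / 2) one_pos (by norm_num)
  obtain ⟨Mg, lo, hi, hlo, hhi, hg⟩ := rho_piece hα (ub := ub) hγ
    ((1 + |a|) * (1 + 4 * Mθ * Mθ)) ((1 + |b|) * (1 + 4 * Mθ * Mθ))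
    (a / 2) (2 * a) (c0 / 2) (b + 1) (ub / 2) (2 * ub)
    (by positivity) (by positivity) (by positivity) (by positivity) (by positivity) (by positivity)
  obtain ⟨MR, hMR⟩ := mean_inv hα hk1 Mg lo hi (-(1 / 2)) hlo hhi
  set C0 : ℝ := 3 * (8 * (8 * MJ * MR) * (1 + 4 * Mθ * Mθ)) with hC0
  set ε : ℝ := min (min 1 (a / 2)) (min (ub / 2) (c0 / (2 * (5 / 2 + ub)))) with hε
  have hε1 : ε ≤ 1 := (min_le_left _ _).trans (min_le_left _ _)
  have hεa : ε ≤ a / 2 := (min_le_left _ _).trans (min_le_right _ _)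
  have hεu : ε ≤ ub / 2 := (min_le_right _ _).trans (min_le_left _ _)
  have hεc : ε * (5 / 2 + ub) ≤ c0 / 2 := by
    have : ε ≤ c0 / (2 * (5 / 2 + ub)) := (min_le_right _ _).trans (min_le_right _ _)
    rw [le_div_iff₀ (by positivity)] at this
    linarith
  have hε0 : 0 < ε := by
    refine lt_min (lt_min one_pos (by positivity)) (lt_min (by positivity) (by positivity))
  refine ⟨|C0| + 1, by positivity, ε, hε0, ?_⟩
  intro δ1 J0 ν0 A0 B0 W1 W2 W3 hD hδ hσ hW
  obtain ⟨mJ, mν, mA, mB⟩ := hD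
  set σ := sigmaCD α γ ρb ub Pb J0 ν0 A0 B0 with hσd
  have nJ := hNorm_one_nonneg α (Icc (0:ℝ) (1/2)) (fun r => J0 r - Jb ρb ub)
  have nν := hNorm_one_nonneg α (Icc (0:ℝ) (1/2)) ν0
  have nA := hNorm_one_nonneg α (Icc (0:ℝ) (1/2)) (fun r => A0 r - a)
  have nB := hNorm_one_nonneg α (Icc (0:ℝ) (1/2)) (fun r => B0 r - b)
  have hσs : σ = hNorm 1 α (Icc (0:ℝ) (1/2)) (fun r => J0 r - Jb ρb ub) +
      hNorm 1 α (Icc (0:ℝ) (1/2)) ν0 + hNorm 1 α (Icc (0:ℝ) (1/2)) (fun r => A0 r - a) +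
      hNorm 1 α (Icc (0:ℝ) (1/2)) (fun r => B0 r - b) := rfl
  have hσ0 : 0 ≤ σ := by rw [hσs]; positivity
  have qJ := (mJ.sub_const (Jb ρb ub)).h1 (M := 1) (by linarith)
  have qν := mν.h1 (M := σ) (by linarith)
  have qA1 := (mA.sub_const a).h1 (M := 1) (by linarith)
  have qB1 := (mB.sub_const b).h1 (M := 1) (by linarith)
  have qAε := (mA.sub_const a).h1 (M := ε) (by linarith)
  have qBε := (mB.sub_const b).h1 (M := ε) (by linarith)
  have hJ3 : H1 α 3 J0 := by
    have := qJ.add_const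
    rw [hJb] at this
    norm_num at this
    exact this
  have hJr : ∀ x ∈ Ioo (0 : ℝ) (1 / 2), J0 x ∈ Icc (1 : ℝ) 3 := by
    intro x hx
    have := abs_le.1 (qJ.b0 x hx)
    rw [hJb] at this
    exact ⟨by linarith [this.1], by linarith [this.2]⟩
  obtain ⟨hθn, hθr⟩ := hθ L J0 hJ3 hJr
  have tJ : Nice L α 0 (3 * (1 + 4 * Mθ * Mθ)) (fun p => tData J0 J0 p.2) :=
    Nice.comp_H1 hα hMθ1 hθn hθr hJ3
  have tν : Nice L α 0 (σ * (1 + 4 * Mθ * Mθ)) (fun p => tData J0 ν0 p.2) :=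
    Nice.comp_H1 hα hMθ1 hθn hθr qν
  have tA : Nice L α 0 ((1 + |a|) * (1 + 4 * Mθ * Mθ)) (fun p => tData J0 A0 p.2) :=
    Nice.comp_H1 hα hMθ1 hθn hθr qA1.add_const
  have tB : Nice L α 0 ((1 + |b|) * (1 + 4 * Mθ * Mθ)) (fun p => tData J0 B0 p.2) :=
    Nice.comp_H1 hα hMθ1 hθn hθr qB1.add_const
  have rJ : ∀ p ∈ Om L, tData J0 J0 p.2 ∈ Icc (1 : ℝ) 3 := fun p hp => hJr _ (hθr p hp)
  have bA : ∀ p ∈ Om L, |tData J0 A0 p.2 - a| ≤ ε := fun p hp => qAε.b0 _ (hθr p hp)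
  have bB : ∀ p ∈ Om L, |tData J0 B0 p.2 - b| ≤ ε := fun p hp => qBε.b0 _ (hθr p hp)
  have n1 := wNorm_one_nonneg α (-α) (Om L) (Sig L) W1
  have n2 := wNorm_one_nonneg α (-α) (Om L) (Sig L) W2
  have n3 := wNorm_one_nonneg α (-α) (Om L) (Sig L) W3
  have hsm := hW.small
  have w1 := hW.mem1.nice hα (M := ε) (by linarith)
  have w2 := hW.mem2.nice hα (M := ε) (by linarith)
  have w3 := hW.mem3.nice hα (M := ε) (by linarith)
  obtain ⟨gN, gr⟩ := hg L (fun p => tData J0 A0 p.2) (fun p => tData J0 B0 p.2) W1 W2 W3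
    tA.zero_one tB.zero_one (w1.mono hε1) (w2.mono hε1) (w3.mono hε1)
    (fun p hp => by
      have := abs_le.1 (bA p hp)
      exact ⟨by linarith [this.1], by linarith [this.2]⟩)
    (fun p hp => by
      have h1 := abs_le.1 (bB p hp)
      have h2 := abs_le.1 (w1.b0 p hp)
      have h3 : W1 p ^ 2 ≤ ε := by
        have := sq_le_sq' h2.1 h2.2
        nlinarith
      have h4 : W2 p ^ 2 ≤ ε := by
        have h := abs_le.1 (w2.b0 p hp)
        have := sq_le_sq' h.1 h.2
        nlinarith
      have h5 : W3 p ^ 2 ≤ ε := by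
        have h := abs_le.1 (w3.b0 p hp)
        have := sq_le_sq' h.1 h.2
        nlinarith
      have h6 : ub * W1 p ≤ ub * ε := mul_le_mul_of_nonneg_left h2.2 hub.le
      refine ⟨?_, ?_⟩
      · have : (W1 p + ub) ^ 2 = W1 p ^ 2 + 2 * (ub * W1 p) + ub ^ 2 := by ring
        rw [this]
        linarith [h1.1]
      · have : 0 ≤ (W1 p + ub) ^ 2 + W2 p ^ 2 + W3 p ^ 2 := by positivity
        linarith [h1.2])
    (fun p hp => by
      have := abs_le.1 (w1.b0 p hp)
      exact ⟨by linarith [this.1], by linarith [this.2]⟩)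
  obtain ⟨j1, j2⟩ := hMJ L _ tJ rJ
  obtain ⟨r1, r2⟩ := hMR L _ gN gr
  have hfin := ((j1.zero_one.mul hα hk1 r1).mul hα hk1 tν.zero_one).congr
    (fun p hp => swirl_eq (tν := tData J0 ν0) hp (lt_of_lt_of_le (by norm_num) (j2 p hp).1)
      (lt_of_lt_of_le (inv_pos.2 hhi) (r2 p hp).1))
  obtain ⟨f1, f2⟩ := hfin.memW hα hbg.hL
  refine ⟨f1, f2.trans ?_⟩
  have : 3 * (8 * (8 * MJ * MR) * (σ * (1 + 4 * Mθ * Mθ))) = C0 * σ := by rw [hC0]; ring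
  rw [this]
  exact mul_le_mul_of_nonneg_right ((le_abs_self _).trans (by linarith)) hσ0

end ContactDisc
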